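/- arXiv:2310.08191 — 4 statements merged into one kernel-verified Lean document; each statement's English description precedes it below -/
import Mathlib

section
/- Let G be a connected simple graph on n vertices and J_G its binomial edge ideal in the polynomial ring S in 2n variables. Then dim(S/J_G) = max{ (n − |T|) + n_c(G∖T) + |T| over cutsets T }, equivalently dim(S/J_G) = max over subsets T ⊆ V(G) of (n − |T|) + c(T) where c(T) is the number of connected components of G∖T; in particular dim(S/J_G) ≥ n + 1. -/
open MvPolynomial

/-- The binomial edge ideal of a simple graph `G`, in the polynomial ring with two
variables `x_v = X (Sum.inl v)` and `y_v = X (Sum.inr v)` for each vertex `v`. -/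
noncomputable def binomialEdgeIdeal {V : Type*} (K : Type*) [Field K] (G : SimpleGraph V) :
    Ideal (MvPolynomial (V ⊕ V) K) :=
  Ideal.span {f | ∃ u v : V, G.Adj u v ∧
    f = X (Sum.inl u) * X (Sum.inr v) - X (Sum.inl v) * X (Sum.inr u)}

/-- The number of connected components of `G` with the vertices of `s` removed. -/
noncomputable def numComp {V : Type*} (G : SimpleGraph V) (s : Set V) : ℕ :=
  Nat.card ((G.induce sᶜ).ConnectedComponent)

/-- `T` is a cutset of `G` if it is empty, or removing any vertex of `T` strictly decreases
the number of connected components of `G` minus `T`. -/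
noncomputable def IsCutset {V : Type*} [DecidableEq V] (G : SimpleGraph V) (T : Finset V) :
    Prop :=
  T = ∅ ∨ ∀ v ∈ T, numComp G ↑(T.erase v) < numComp G ↑T

universe u

/-- Krull dimension is invariant under injective integral extensions. -/
theorem bei_dim_integral {R S : Type*} [CommRing R] [CommRing S] [Algebra R S]
    [Algebra.IsIntegral R S] [FaithfulSMul R S] :
    ringKrullDim S = ringKrullDim R := by
  apply le_antisymm
  · refine Order.krullDim_le_of_strictMono (PrimeSpectrum.comap (algebraMap R S)) ?_
    intro p q hpq
    have : p.asIdeal < q.asIdeal := hpq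
    exact Ideal.IsIntegral.comap_lt_comap this
  · refine iSup_le fun l => ?_
    obtain ⟨Q, hQ⟩ := Ideal.nonempty_primesOver (S := S) (l.head.asIdeal)
    obtain ⟨hQ1, hQ2⟩ := hQ
    obtain ⟨L, hL, -, -⟩ := Ideal.exists_ltSeries_of_hasGoingUp l Q
    rw [← hL]
    exact le_iSup (fun l : LTSeries (PrimeSpectrum S) => (l.length : WithBot ℕ∞)) L

/-- For affine domains, Krull dimension is transcendence degree. -/
theorem bei_dim_trdeg {K D : Type u} [Field K] [CommRing D] [IsDomain D] [Algebra K D]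
    [Algebra.FiniteType K D] :
    ∃ s : ℕ, Algebra.trdeg K D = s ∧ ringKrullDim D = s := by
  obtain ⟨s, g, hg, hgi⟩ := exists_integral_inj_algHom_of_fg K D
  refine ⟨s, ?_, ?_⟩
  all_goals
    let : Algebra (MvPolynomial (Fin s) K) D := g.toRingHom.toAlgebra
    have : IsScalarTower K (MvPolynomial (Fin s) K) D :=
      IsScalarTower.of_algebraMap_eq (fun x => (g.commutes x).symm)
    have : Algebra.IsIntegral (MvPolynomial (Fin s) K) D := ⟨hgi⟩
    have : FaithfulSMul (MvPolynomial (Fin s) K) D :=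
      (faithfulSMul_iff_algebraMap_injective _ _).mpr hg
  · rw [← _root_.trdeg_add_eq K (MvPolynomial (Fin s) K) (A := D)]
    have : Algebra.IsAlgebraic (MvPolynomial (Fin s) K) D := inferInstance
    rw [_root_.trdeg_eq_zero (R := MvPolynomial (Fin s) K) (A := D)]
    simp
  · rw [bei_dim_integral (R := MvPolynomial (Fin s) K)]
    simp

theorem bei_dim_le_of_primes {R : Type*} [CommRing R] (N : WithBot ℕ∞)
    (h : ∀ P : Ideal R, P.IsPrime → ringKrullDim (R ⧸ P) ≤ N) : ringKrullDim R ≤ N := by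
  rw [ringKrullDim, Order.krullDim_eq_iSup_coheight]
  refine iSup_le fun p => ?_
  rw [Order.coheight_eq_krullDim_Ici]
  refine le_trans (le_of_eq ?_) (h p.asIdeal p.isPrime)
  rw [ringKrullDim_quotient]
  congr 1

/-- All generators algebraic implies algebraic. -/
theorem bei_alg_of_gens {K A D σ : Type*} [Field K] [CommRing A] [IsDomain A] [CommRing D]
    [IsDomain D] [Algebra K D] [Algebra K A] [Algebra A D] [IsScalarTower K A D]
    (φ : MvPolynomial σ K →ₐ[K] D) (hφ : Function.Surjective φ)
    (h : ∀ i, IsAlgebraic A (φ (X i))) : Algebra.IsAlgebraic A D := by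
  refine ⟨fun d => ?_⟩
  obtain ⟨p, rfl⟩ := hφ d
  induction p using MvPolynomial.induction_on with
  | C a =>
    have : φ (C a) = algebraMap A D (algebraMap K A a) := by
      rw [← IsScalarTower.algebraMap_apply]; exact φ.commutes a
    rw [this]; exact isAlgebraic_algebraMap _
  | add p q hp hq => rw [map_add]; exact hp.add hq
  | mul_X p i hp => rw [map_mul]; exact hp.mul (h i)

/-- Transitivity of proportionality. -/
theorem bei_prop_of_reachable {V D : Type*} [CommRing D] [IsDomain D] (H : SimpleGraph V)
    (x y : V → D) (hne : ∀ v, x v ≠ 0 ∨ y v ≠ 0)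
    (hadj : ∀ u v, H.Adj u v → x u * y v = x v * y u) {u v : V} (huv : H.Reachable u v) :
    x u * y v = x v * y u := by
  obtain ⟨w⟩ := huv
  induction w with
  | nil => ring
  | @cons u v w h p ih =>
    have h1 := hadj u v h
    rcases hne v with hv | hv
    · apply mul_left_cancel₀ hv
      linear_combination x u * ih + x w * h1
    · apply mul_left_cancel₀ hv
      linear_combination y w * h1 + y u * ih

theorem bei_card {n : ℕ} (G : SimpleGraph (Fin n)) (T : Finset (Fin n)) :
    Nat.card (((T : Set (Fin n))ᶜ : Set (Fin n)) ⊕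
      (G.induce ((T : Set (Fin n))ᶜ)).ConnectedComponent) = (n - T.card) + numComp G ↑T := by
  classical
  rw [Nat.card_sum, numComp]
  congr 1
  rw [← Finset.coe_compl, Nat.card_coe_set_eq, Set.ncard_coe_finset, Finset.card_compl,
    Fintype.card_fin]

theorem bei_upper {n : ℕ} {K D : Type u} [Field K] (G : SimpleGraph (Fin n)) [CommRing D]
    [IsDomain D] [Algebra K D] (φ : MvPolynomial (Fin n ⊕ Fin n) K →ₐ[K] D)
    (hφ : Function.Surjective φ) (hJ : ∀ f ∈ binomialEdgeIdeal K G, φ f = 0) :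
    ∃ T : Finset (Fin n), ringKrullDim D ≤ (((n - T.card) + numComp G ↑T : ℕ) : WithBot ℕ∞) := by
  classical
  let x : Fin n → D := fun v => φ (X (Sum.inl v))
  let y : Fin n → D := fun v => φ (X (Sum.inr v))
  let T : Finset (Fin n) := Finset.univ.filter fun v => x v = 0 ∧ y v = 0
  refine ⟨T, ?_⟩
  let H := G.induce ((T : Set (Fin n))ᶜ)
  have hadj : ∀ u v, G.Adj u v → x u * y v = x v * y u := by
    intro u v huv
    have := hJ _ (Ideal.subset_span ⟨u, v, huv, rfl⟩)
    rw [map_sub, map_mul, map_mul, sub_eq_zero] at this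
    exact this
  have hne : ∀ v : ((T : Set (Fin n))ᶜ : Set (Fin n)), x v ≠ 0 ∨ y v ≠ 0 := by
    rintro ⟨v, hv⟩
    have : v ∉ T := hv
    simp only [T, Finset.mem_filter, Finset.mem_univ, true_and] at this
    tauto
  have hreach : ∀ u v, H.Reachable u v → x u * y v = x v * y u := fun u v huv =>
    bei_prop_of_reachable H (fun v => x v) (fun v => y v) hne
      (fun u v h => hadj u v h) huv
  let r : H.ConnectedComponent → ((T : Set (Fin n))ᶜ : Set (Fin n)) := fun C => C.out
  have hr : ∀ v, H.Reachable v (r (H.connectedComponentMk v)) := by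
    intro v
    apply SimpleGraph.ConnectedComponent.exact
    exact (Quot.out_eq (H.connectedComponentMk v)).symm
  let f : ((T : Set (Fin n))ᶜ : Set (Fin n)) ⊕ H.ConnectedComponent → D := Sum.elim
    (fun v => if x (r (H.connectedComponentMk v)) = 0 then y v else x v)
    (fun C => if x (r C) = 0 then x (r C) else y (r C))
  let A := Algebra.adjoin K (Set.range f)
  have hmem : ∀ i, IsAlgebraic A (f i) := fun i =>
    isAlgebraic_algebraMap (⟨f i, Algebra.subset_adjoin ⟨i, rfl⟩⟩ : A)
  have halg : Algebra.IsAlgebraic A D := by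
    have key : ∀ v, IsAlgebraic A (x v) ∧ IsAlgebraic A (y v) := by
      intro v
      by_cases hv : v ∈ T
      · simp only [T, Finset.mem_filter, Finset.mem_univ, true_and] at hv
        rw [hv.1, hv.2]
        exact ⟨isAlgebraic_zero, isAlgebraic_zero⟩
      · let v' : ((T : Set (Fin n))ᶜ : Set (Fin n)) := ⟨v, hv⟩
        let C := H.connectedComponentMk v'
        have h1 := hreach _ _ (hr v')
        have e1 := hmem (Sum.inl v')
        have e2 := hmem (Sum.inr C)
        have e3 := hmem (Sum.inl (r C))
        have hC : H.connectedComponentMk (r C) = C := Quot.out_eq C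
        simp only [f, Sum.elim_inl, Sum.elim_inr, hC] at e1 e2 e3
        change IsAlgebraic A (if x (r C) = 0 then y v else x v) at e1
        change x v * y (r C) = x (r C) * y v at h1
        by_cases h0 : x (r C) = 0
        · simp only [h0, if_true] at e1 e2 e3
          have hy : y (r C) ≠ 0 := by
            rcases hne (r C) with h | h
            · exact absurd h0 h
            · exact h
          rw [h0, zero_mul] at h1
          have hx : x v = 0 := (mul_eq_zero.mp h1).resolve_right hy
          rw [hx]
          exact ⟨isAlgebraic_zero, e1⟩
        · simp only [h0, if_false] at e1 e2 e3
          refine ⟨e1, IsAlgebraic.of_mul (mem_nonZeroDivisors_of_ne_zero h0) e3 ?_⟩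
          rw [← h1]
          exact e1.mul e2
    refine bei_alg_of_gens φ hφ ?_
    rintro (v | v)
    · exact (key v).1
    · exact (key v).2
  have : Algebra.FiniteType K D := Algebra.FiniteType.of_surjective φ hφ
  obtain ⟨s, hs, hd⟩ := bei_dim_trdeg (K := K) (D := D)
  rw [hd]
  have h1 := Algebra.IsAlgebraic.trdeg_le_cardinalMk K (Set.range f)
  rw [hs] at h1
  have h2 : Nat.card (Set.range f) ≤ (n - T.card) + numComp G ↑T := by
    rw [← bei_card]
    exact Finite.card_range_le f
  have h3 : s ≤ Nat.card (Set.range f) := by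
    rw [← Nat.cast_card] at h1
    exact_mod_cast h1
  exact_mod_cast h3.trans h2

theorem bei_lower {n : ℕ} {K : Type u} [Field K] (G : SimpleGraph (Fin n)) (T : Finset (Fin n)) :
    (((n - T.card) + numComp G ↑T : ℕ) : WithBot ℕ∞) ≤
      ringKrullDim (MvPolynomial (Fin n ⊕ Fin n) K ⧸ binomialEdgeIdeal K G) := by
  classical
  let H := G.induce ((T : Set (Fin n))ᶜ)
  let I := ((T : Set (Fin n))ᶜ : Set (Fin n)) ⊕ H.ConnectedComponent
  let R := MvPolynomial I K
  let x : Fin n → R := fun v => if h : v ∈ T then 0 else X (Sum.inl ⟨v, h⟩)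
  let y : Fin n → R := fun v => if h : v ∈ T then 0 else
    X (Sum.inl ⟨v, h⟩) * X (Sum.inr (H.connectedComponentMk ⟨v, h⟩))
  let φ : MvPolynomial (Fin n ⊕ Fin n) K →ₐ[K] R := aeval (Sum.elim x y)
  have hφx : ∀ v, φ (X (Sum.inl v)) = x v := fun v => by simp [φ]
  have hφy : ∀ v, φ (X (Sum.inr v)) = y v := fun v => by simp [φ]
  have hJ : ∀ f ∈ binomialEdgeIdeal K G, φ.rangeRestrict.toRingHom f = 0 := by
    change binomialEdgeIdeal K G ≤ RingHom.ker φ.rangeRestrict.toRingHom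
    refine Ideal.span_le.mpr ?_
    rintro f ⟨u, v, huv, rfl⟩
    change φ.rangeRestrict _ = 0
    apply Subtype.ext
    change φ _ = 0
    rw [map_sub, map_mul, map_mul, hφx, hφy, hφx, hφy]
    by_cases hu : u ∈ T
    · simp [x, y, hu]
    by_cases hv : v ∈ T
    · simp [x, y, hv]
    have hc : H.connectedComponentMk ⟨u, hu⟩ = H.connectedComponentMk ⟨v, hv⟩ := by
      apply SimpleGraph.ConnectedComponent.sound
      exact SimpleGraph.Adj.reachable huv
    simp only [x, y, hu, hv, dif_neg, not_false_eq_true, hc]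
    ring
  have hle : ringKrullDim φ.range ≤
      ringKrullDim (MvPolynomial (Fin n ⊕ Fin n) K ⧸ binomialEdgeIdeal K G) := by
    refine ringKrullDim_le_of_surjective
      (Ideal.Quotient.lift (binomialEdgeIdeal K G) φ.rangeRestrict.toRingHom hJ) ?_
    apply Ideal.Quotient.lift_surjective_of_surjective
    exact φ.rangeRestrict_surjective
  refine le_trans ?_ hle
  have : Algebra.FiniteType K φ.range :=
    Algebra.FiniteType.of_surjective φ.rangeRestrict φ.rangeRestrict_surjective
  obtain ⟨s, hs, hd⟩ := bei_dim_trdeg (K := K) (D := φ.range)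
  have hmem : ∀ p, IsAlgebraic φ.range (φ p) := fun p =>
    isAlgebraic_algebraMap (⟨φ p, ⟨p, rfl⟩⟩ : φ.range)
  have hX : ∀ v : ((T : Set (Fin n))ᶜ : Set (Fin n)),
      IsAlgebraic φ.range (X (Sum.inl v) : R) := by
    rintro ⟨v, hv⟩
    have hv' : v ∉ T := hv
    have := hmem (X (Sum.inl v))
    rw [hφx] at this
    simpa only [x, hv', dif_neg, not_false_eq_true] using this
  have halg : Algebra.IsAlgebraic φ.range R := by
    refine bei_alg_of_gens (AlgHom.id K R) Function.surjective_id ?_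
    rintro (v | C)
    · exact hX v
    · induction C using SimpleGraph.ConnectedComponent.ind with
      | h v =>
        refine IsAlgebraic.of_mul (y := X (Sum.inl v))
          (mem_nonZeroDivisors_of_ne_zero (X_ne_zero _)) (hX v) ?_
        obtain ⟨v, hv⟩ := v
        have hv' : v ∉ T := hv
        have := hmem (X (Sum.inr v))
        rw [hφy] at this
        simp only [y, hv', dif_neg, not_false_eq_true] at this
        exact this
  have htr := _root_.trdeg_add_eq K φ.range (A := R)
  rw [_root_.trdeg_eq_zero (R := φ.range) (A := R), hs, add_zero, MvPolynomial.trdeg_of_isDomain,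
    ← Nat.cast_card, Cardinal.lift_natCast, bei_card] at htr
  have : s = (n - T.card) + numComp G ↑T := by exact_mod_cast htr
  rw [hd, this]

theorem bei_cutset_sup {n : ℕ} (G : SimpleGraph (Fin n)) (T : Finset (Fin n)) :
    ∃ T', IsCutset G T' ∧ (n - T.card) + numComp G ↑T ≤ (n - T'.card) + numComp G ↑T' := by
  induction hk : T.card generalizing T with
  | zero => exact ⟨T, Or.inl (Finset.card_eq_zero.mp hk), by rw [hk]⟩
  | succ k ih =>
    by_cases hc : IsCutset G T
    · exact ⟨T, hc, by rw [hk]⟩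
    · unfold IsCutset at hc
      push Not at hc
      obtain ⟨v, hv, hle⟩ := hc.2
      have hcard : (T.erase v).card = k := by rw [Finset.card_erase_of_mem hv, hk]; rfl
      obtain ⟨T', h1, h2⟩ := ih (T.erase v) hcard
      exact ⟨T', h1, by omega⟩

theorem dim_binomialEdgeIdeal {n : ℕ} (K : Type*) [Field K]
    (G : SimpleGraph (Fin n)) (hG : G.Connected) [DecidablePred (IsCutset G)] :
    ringKrullDim (MvPolynomial (Fin n ⊕ Fin n) K ⧸ binomialEdgeIdeal K G)
        = (((Finset.univ.filter (IsCutset G)).sup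
            (fun T : Finset (Fin n) => (n - T.card) + numComp G ↑T) : ℕ) :
            WithBot (WithTop ℕ)) ∧
    ringKrullDim (MvPolynomial (Fin n ⊕ Fin n) K ⧸ binomialEdgeIdeal K G)
        = ((Finset.univ.sup
            (fun T : Finset (Fin n) => (n - T.card) + numComp G ↑T) : ℕ) :
            WithBot (WithTop ℕ)) ∧
    ((n + 1 : ℕ) : WithBot (WithTop ℕ))
        ≤ ringKrullDim (MvPolynomial (Fin n ⊕ Fin n) K ⧸ binomialEdgeIdeal K G) := by
  have hsup : (Finset.univ.filter (IsCutset G)).sup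
      (fun T : Finset (Fin n) => (n - T.card) + numComp G ↑T) =
      Finset.univ.sup (fun T : Finset (Fin n) => (n - T.card) + numComp G ↑T) := by
    apply le_antisymm
    · exact Finset.sup_mono (Finset.filter_subset _ _)
    · refine Finset.sup_le fun T _ => ?_
      obtain ⟨T', h1, h2⟩ := bei_cutset_sup G T
      exact h2.trans (Finset.le_sup (f := fun T : Finset (Fin n) => (n - T.card) + numComp G ↑T)
        (Finset.mem_filter.mpr ⟨Finset.mem_univ _, h1⟩))
  have hmain : ringKrullDim (MvPolynomial (Fin n ⊕ Fin n) K ⧸ binomialEdgeIdeal K G)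
        = ((Finset.univ.sup
            (fun T : Finset (Fin n) => (n - T.card) + numComp G ↑T) : ℕ) :
            WithBot (WithTop ℕ)) := by
    apply le_antisymm
    · refine bei_dim_le_of_primes _ fun P hP => ?_
      obtain ⟨T, hT⟩ := bei_upper G
        ((Ideal.Quotient.mkₐ K P).comp (Ideal.Quotient.mkₐ K (binomialEdgeIdeal K G)))
        ((Ideal.Quotient.mkₐ_surjective K P).comp (Ideal.Quotient.mkₐ_surjective K _))
        (fun f hf => by
          rw [AlgHom.comp_apply, Ideal.Quotient.mkₐ_eq_mk K (binomialEdgeIdeal K G),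
            Ideal.Quotient.eq_zero_iff_mem.mpr hf, map_zero])
      refine hT.trans ?_
      have := Finset.le_sup (f := fun T : Finset (Fin n) => (n - T.card) + numComp G ↑T)
        (Finset.mem_univ T)
      exact (Nat.cast_le (α := WithBot ℕ∞)).mpr this
    · obtain ⟨T, -, hT⟩ := Finset.exists_mem_eq_sup Finset.univ Finset.univ_nonempty
        (fun T : Finset (Fin n) => (n - T.card) + numComp G ↑T)
      rw [hT]
      exact bei_lower G T
  refine ⟨by rw [hsup]; exact hmain, hmain, ?_⟩
  refine le_trans ?_ (bei_lower G ∅)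
  have h1 : 1 ≤ numComp G ((∅ : Finset (Fin n)) : Set (Fin n)) := by
    obtain ⟨v⟩ := hG.nonempty
    have hne : Nonempty (G.induce ((((∅ : Finset (Fin n)) : Set (Fin n)))ᶜ)).ConnectedComponent :=
      ⟨SimpleGraph.connectedComponentMk _ ⟨v, by simp⟩⟩
    exact Nat.card_pos
  have h2 : n + 1 ≤ n - (∅ : Finset (Fin n)).card + numComp G ((∅ : Finset (Fin n)) : Set (Fin n)) := by
    rw [Finset.card_empty]; omega
  exact (Nat.cast_le (α := WithBot ℕ∞)).mpr h2
end

section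
/- Let G_k (k ≥ 3) be the graph on {x_1,...,x_k, y_1,...,y_k} with edges {x_2,y_i} (i ≠ 2), {x_j,y_2} (j ≠ 2), and {x_m,y_m} (m ≠ 2), and let J_{G_k} be its binomial edge ideal in S = K[x-variables, y-variables] (4k variables). Then dim(S/J_{G_k}) = 7 if k = 3, and dim(S/J_{G_k}) = 3k − 3 if k ≥ 4. -/
open MvPolynomial

/-- The Levi graph `G_k` of the Hirzebruch quasi-pencil of `k` lines: vertices
`x_i = Sum.inl i` and `y_i = Sum.inr i`, with distinguished index `a` (playing the role of
the index `2`), and edges `{x_a, y_i}` (`i ≠ a`), `{x_j, y_a}` (`j ≠ a`) and `{x_m, y_m}`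
(`m ≠ a`). -/
def quasiPencilGraph (k : ℕ) (a : Fin k) : SimpleGraph (Fin k ⊕ Fin k) :=
  SimpleGraph.fromRel (fun u v => ∃ i j : Fin k, u = Sum.inl i ∧ v = Sum.inr j ∧
    (i = a ∨ j = a ∨ i = j) ∧ ¬(i = a ∧ j = a))

universe u

lemma qp_dim_le_of_integral {A R : Type*} [CommRing A] [CommRing R] [Algebra A R]
    [Algebra.IsIntegral A R] : ringKrullDim R ≤ ringKrullDim A := by
  refine Order.krullDim_le_of_strictMono (PrimeSpectrum.comap (algebraMap A R)) ?_
  intro p q h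
  exact Ideal.IsIntegral.comap_lt_comap (I := p.asIdeal) (J := q.asIdeal) h

lemma qp_lift_series {A R : Type*} [CommRing A] [CommRing R] [Algebra A R]
    [Algebra.IsIntegral A R] (hinj : Function.Injective (algebraMap A R)) (n : ℕ) :
    ∀ l : LTSeries (PrimeSpectrum A), l.length = n →
      ∃ l' : LTSeries (PrimeSpectrum R), l'.length = n ∧
        PrimeSpectrum.comap (algebraMap A R) l'.last = l.last := by
  induction n with
  | zero =>
    intro l hl
    obtain ⟨Q, -, hQ, hQ2⟩ := Ideal.exists_ideal_over_prime_of_isIntegral (S := R) l.last.asIdeal ⊥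
      (by
        intro x hx
        have : algebraMap A R x = 0 := by simpa using hx
        rw [(injective_iff_map_eq_zero _).1 hinj x this]
        exact zero_mem _)
    refine ⟨RelSeries.singleton _ ⟨Q, hQ⟩, rfl, ?_⟩
    ext1
    exact hQ2
  | succ n ih =>
    intro l hl
    obtain ⟨l', hl', h⟩ := ih l.eraseLast (by simp [hl])
    have hlt : l.eraseLast.last < l.last := by
      exact RelSeries.eraseLast_last_rel_last l (by omega)
    obtain ⟨Q, hQ0, hQ, hQ2⟩ := Ideal.exists_ideal_over_prime_of_isIntegral (S := R) l.last.asIdeal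
      l'.last.asIdeal (by
        have : (PrimeSpectrum.comap (algebraMap A R) l'.last).asIdeal ≤ l.last.asIdeal := by
          rw [h]; exact hlt.le
        exact this)
    refine ⟨l'.snoc ⟨Q, hQ⟩ ?_, ?_, ?_⟩
    · refine lt_of_le_of_ne hQ0 ?_
      intro h2
      have : PrimeSpectrum.comap (algebraMap A R) l'.last = l.last := by
        ext1; rw [← hQ2, ← h2]; rfl
      rw [← this, h] at hlt
      exact lt_irrefl _ hlt
    · simp [hl']
    · simp only [RelSeries.last_snoc]
      ext1
      exact hQ2

lemma qp_dim_eq_of_integral {A R : Type*} [CommRing A] [CommRing R] [Algebra A R]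
    [Algebra.IsIntegral A R] (hinj : Function.Injective (algebraMap A R)) :
    ringKrullDim R = ringKrullDim A := by
  refine le_antisymm qp_dim_le_of_integral ?_
  refine iSup_le fun l => ?_
  obtain ⟨l', hl', -⟩ := qp_lift_series hinj _ l rfl
  rw [← hl']
  exact Order.LTSeries.length_le_krullDim l'

lemma qp_dim_eq_trdeg (K R : Type u) [Field K] [CommRing R] [IsDomain R] [Algebra K R]
    [Algebra.FiniteType K R] :
    ∃ s : ℕ, ringKrullDim R = s ∧ Algebra.trdeg K R = s := by
  obtain ⟨s, g, hg, hgint⟩ := exists_integral_inj_algHom_of_fg K R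
  refine ⟨s, ?_, ?_⟩
  · algebraize [g.toRingHom]
    have : Algebra.IsIntegral (MvPolynomial (Fin s) K) R := ⟨hgint⟩
    rw [qp_dim_eq_of_integral (A := MvPolynomial (Fin s) K) hg,
      MvPolynomial.ringKrullDim_of_isNoetherianRing]
    simp [ringKrullDim_eq_zero_of_field]
  · algebraize [g.toRingHom]
    have : Algebra.IsIntegral (MvPolynomial (Fin s) K) R := ⟨hgint⟩
    have : IsScalarTower K (MvPolynomial (Fin s) K) R :=
      IsScalarTower.of_algebraMap_eq fun x => (g.commutes x).symm
    have : FaithfulSMul (MvPolynomial (Fin s) K) R := 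
      (faithfulSMul_iff_algebraMap_injective _ _).2 hg
    have := trdeg_add_eq K (MvPolynomial (Fin s) K) (A := R)
    rw [trdeg_eq_zero (R := MvPolynomial (Fin s) K) (A := R), MvPolynomial.trdeg_of_isDomain] at this
    simpa using this.symm

lemma qp_dim_quotient_le {R : Type*} [CommRing R] (J : Ideal R) (N : ℕ)
    (h : ∀ p : Ideal R, p.IsPrime → J ≤ p → ringKrullDim (R ⧸ p) ≤ N) :
    ringKrullDim (R ⧸ J) ≤ N := by
  rw [ringKrullDim_quotient]
  refine iSup_le fun l => ?_
  refine le_trans ?_ (h l.head.1.asIdeal l.head.1.isPrime l.head.2)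
  rw [ringKrullDim_quotient]
  let l' : LTSeries (PrimeSpectrum.zeroLocus (R := R) l.head.1.asIdeal) :=
    { length := l.length
      toFun := fun i => ⟨(l i).1, (l.head_le i : l.head ≤ l i)⟩
      step := fun i => l.step i }
  exact Order.LTSeries.length_le_krullDim l'

lemma qp_isAlgebraic_of_mul {A R : Type*} [CommRing A] [Nontrivial A] [CommRing R] [Algebra A R]
    (r s : A) (z : R) (hs : s ≠ 0)
    (h : algebraMap A R s * z = algebraMap A R r) : IsAlgebraic A z := by
  refine ⟨Polynomial.C s * Polynomial.X - Polynomial.C r, ?_, ?_⟩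
  · intro h0
    have := congrArg (fun p => Polynomial.coeff p 1) h0
    simp [Polynomial.coeff_C] at this
    exact hs this
  · simp [h]

lemma qp_trdeg_le {K F : Type u} [Field K] [Field F] [Algebra K F] (E : Finset F)
    (h : ∀ z : F, z ∈ IntermediateField.adjoin K (E : Set F)) :
    Algebra.trdeg K F ≤ E.card := by
  have : Algebra.IsAlgebraic (Algebra.adjoin K (E : Set F)) F := by
    constructor
    intro z
    obtain ⟨r, hr, s, hs, hz⟩ := (IntermediateField.mem_adjoin_iff_div).1 (h z)
    by_cases hs0 : s = 0
    · rw [hz, hs0, div_zero]; exact isAlgebraic_zero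
    · refine qp_isAlgebraic_of_mul (⟨r, hr⟩ : Algebra.adjoin K (E : Set F)) ⟨s, hs⟩ z ?_ ?_
      · intro h; exact hs0 (congrArg Subtype.val h)
      · change s * z = r
        rw [hz]; field_simp
  have := Algebra.IsAlgebraic.trdeg_le_cardinalMk K (E : Set F)
  simpa using this

lemma qp_upper {σ : Type} [Finite σ] {K : Type u} [Field K] (J : Ideal (MvPolynomial σ K)) (N : ℕ)
    (h : ∀ (F : Type u) [Field F] [Algebra K F] (φ : MvPolynomial σ K →ₐ[K] F),
      (∀ x ∈ J, φ x = 0) → ∃ E : Finset F, E.card ≤ N ∧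
        ∀ M : IntermediateField K F, (E : Set F) ⊆ M → ∀ s, φ (X s) ∈ M) :
    ringKrullDim (MvPolynomial σ K ⧸ J) ≤ N := by
  refine qp_dim_quotient_le J N fun p hp hJ => ?_
  obtain ⟨s, h1, h2⟩ := qp_dim_eq_trdeg K (MvPolynomial σ K ⧸ p)
  rw [h1]
  let F := FractionRing (MvPolynomial σ K ⧸ p)
  let ψ : (MvPolynomial σ K ⧸ p) →ₐ[K] F := IsScalarTower.toAlgHom K _ F
  have hψ : Function.Injective ψ := IsFractionRing.injective (MvPolynomial σ K ⧸ p) F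
  obtain ⟨E, hE, hM⟩ := h F (ψ.comp (Ideal.Quotient.mkₐ K p)) (by
    intro x hx
    have : Ideal.Quotient.mkₐ K p x = 0 := Ideal.Quotient.eq_zero_iff_mem.2 (hJ hx)
    simp only [AlgHom.comp_apply, this, map_zero])
  have h3 := qp_trdeg_le (K := K) E (by
    have hX := hM (IntermediateField.adjoin K (E : Set F)) (IntermediateField.subset_adjoin _ _)
    have hall : ∀ a : MvPolynomial σ K ⧸ p, ψ a ∈ IntermediateField.adjoin K (E : Set F) := by
      intro a
      obtain ⟨q, rfl⟩ := Ideal.Quotient.mk_surjective a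
      change (ψ.comp (Ideal.Quotient.mkₐ K p)) q ∈ _
      induction q using MvPolynomial.induction_on with
      | C a =>
        have : (C a : MvPolynomial σ K) = algebraMap K _ a := rfl
        rw [this, AlgHom.commutes]
        exact IntermediateField.algebraMap_mem _ _
      | add p q hp hq => rw [map_add]; exact add_mem hp hq
      | mul_X p i hp => rw [map_mul]; exact mul_mem hp (hX i)
    intro z
    obtain ⟨a, b, -, rfl⟩ := IsFractionRing.div_surjective (A := MvPolynomial σ K ⧸ p) z
    exact div_mem (hall a) (hall b))
  have h4 := trdeg_le_of_injective ψ hψ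
  rw [h2] at h4
  have : s ≤ N := by
    have := h4.trans h3
    exact (Nat.cast_le.1 this).trans hE
  exact_mod_cast this

lemma qp_lower {σ τ : Type} [Finite σ] [Fintype τ] {K : Type u} [Field K]
    (J : Ideal (MvPolynomial σ K)) (φ : MvPolynomial σ K →ₐ[K] MvPolynomial τ K)
    (hJ : ∀ x ∈ J, φ x = 0)
    (h : ∀ t : τ, ∃ r s : MvPolynomial σ K, φ s ≠ 0 ∧ φ s * X t = φ r) :
    (Fintype.card τ : WithBot ℕ∞) ≤ ringKrullDim (MvPolynomial σ K ⧸ J) := by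
  have hft : Algebra.FiniteType K φ.range :=
    Algebra.FiniteType.of_surjective φ.rangeRestrict φ.rangeRestrict_surjective
  obtain ⟨s, h1, h2⟩ := qp_dim_eq_trdeg K φ.range
  have halg : Algebra.IsAlgebraic φ.range (MvPolynomial τ K) := by
    constructor
    intro z
    induction z using MvPolynomial.induction_on with
    | C a =>
      exact isAlgebraic_algebraMap (⟨C a, ⟨C a, by exact φ.commutes a⟩⟩ : φ.range)
    | add p q hp hq => exact hp.add hq
    | mul_X p i hp =>
      refine hp.mul ?_
      obtain ⟨r, s, hs, hrs⟩ := h i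
      refine qp_isAlgebraic_of_mul (⟨φ r, r, rfl⟩ : φ.range) ⟨φ s, s, rfl⟩ _ ?_ hrs
      intro h; exact hs (congrArg Subtype.val h)
  have h3 := trdeg_add_eq K φ.range (A := MvPolynomial τ K)
  rw [trdeg_eq_zero (R := φ.range) (A := MvPolynomial τ K), MvPolynomial.trdeg_of_isDomain, h2] at h3
  have h4 : s = Fintype.card τ := by simpa using h3
  rw [← h4, ← h1]
  let f : (MvPolynomial σ K ⧸ J) →+* φ.range :=
    Ideal.Quotient.lift J φ.rangeRestrict.toRingHom (by
      intro a ha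
      exact Subtype.ext (hJ a ha))
  refine ringKrullDim_le_of_surjective f ?_
  exact Ideal.Quotient.lift_surjective_of_surjective _ _ φ.rangeRestrict_surjective

noncomputable def qpLam {F : Type*} [Field F] (x y : F) : F := by
  classical exact if x ≠ 0 then x else y

noncomputable def qpSig {F : Type*} [Field F] (x y : F) : F := by
  classical exact if x ≠ 0 then y / x else 0

section
variable {K F : Type*} [Field K] [Field F] [Algebra K F]

lemma qp_recon (M : IntermediateField K F) {x y : F} (h1 : qpLam x y ∈ M) (h2 : qpSig x y ∈ M) :
    x ∈ M ∧ y ∈ M := by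
  unfold qpLam at h1
  unfold qpSig at h2
  by_cases hx : x = 0
  · simp [hx] at h1 ⊢
    exact h1
  · simp [hx] at h1 h2
    refine ⟨h1, ?_⟩
    have := mul_mem h2 h1
    rwa [div_mul_cancel₀ _ hx] at this

lemma qp_sig_eq {x y z w : F} (h : x * w = z * y) (h1 : ¬(x = 0 ∧ y = 0)) (h2 : ¬(z = 0 ∧ w = 0)) :
    qpSig x y = qpSig z w := by
  unfold qpSig
  by_cases hx : x = 0
  · subst hx
    have : z = 0 := by
      by_contra hz
      simp [hz] at h
      exact h1 ⟨rfl, h⟩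
    simp [this]
  · have hz : z ≠ 0 := by
      rintro rfl
      simp [hx] at h
      exact h2 ⟨rfl, h⟩
    simp only [ne_eq, hx, hz, not_false_eq_true, if_true]
    field_simp
    linear_combination -h

lemma qp_zero_mem (M : IntermediateField K F) {x y : F} (h : x = 0 ∧ y = 0) : x ∈ M ∧ y ∈ M := by
  rw [h.1, h.2]; exact ⟨zero_mem _, zero_mem _⟩

/-- Path with both hubs zero. -/
lemma qp_path3 {x y z w : F} (h : x * w = z * y) :
    ∃ E : Finset F, E.card ≤ 3 ∧ ∀ M : IntermediateField K F, (E : Set F) ⊆ M →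
      (x ∈ M ∧ y ∈ M) ∧ (z ∈ M ∧ w ∈ M) := by
  classical
  by_cases h1 : x = 0 ∧ y = 0
  · refine ⟨{qpLam z w, qpSig z w}, Finset.card_le_two.trans (by norm_num), fun M hM => ?_⟩
    simp [Set.insert_subset_iff] at hM
    exact ⟨qp_zero_mem M h1, qp_recon M hM.1 hM.2⟩
  · refine ⟨{qpLam x y, qpLam z w, qpSig x y}, Finset.card_le_three, fun M hM => ?_⟩
    simp [Set.insert_subset_iff] at hM
    refine ⟨qp_recon M hM.1 hM.2.2, ?_⟩
    by_cases h2 : z = 0 ∧ w = 0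
    · exact qp_zero_mem M h2
    · exact qp_recon M hM.2.1 (qp_sig_eq h h1 h2 ▸ hM.2.2)

/-- Path whose first vertex is adjacent to a nonzero hub. -/
lemma qp_path2 {x y z w s t : F} (h : x * w = z * y) (hs : s * y = x * t)
    (h0 : ¬(s = 0 ∧ t = 0)) :
    ∃ E : Finset F, E.card ≤ 2 ∧ ∀ M : IntermediateField K F, (E : Set F) ⊆ M → qpSig s t ∈ M →
      (x ∈ M ∧ y ∈ M) ∧ (z ∈ M ∧ w ∈ M) := by
  classical
  by_cases h1 : x = 0 ∧ y = 0
  · refine ⟨{qpLam z w, qpSig z w}, Finset.card_le_two, fun M hM _ => ?_⟩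
    simp [Set.insert_subset_iff] at hM
    exact ⟨qp_zero_mem M h1, qp_recon M hM.1 hM.2⟩
  · refine ⟨{qpLam x y, qpLam z w}, Finset.card_le_two, fun M hM hM2 => ?_⟩
    simp [Set.insert_subset_iff] at hM
    rw [qp_sig_eq hs h0 h1] at hM2
    refine ⟨qp_recon M hM.1 hM2, ?_⟩
    by_cases h2 : z = 0 ∧ w = 0
    · exact qp_zero_mem M h2
    · exact qp_recon M hM.2 (qp_sig_eq h h1 h2 ▸ hM2)

/-- Path between two nonzero hubs of different slopes. -/
lemma qp_path1 {x y z w s t s' t' : F} (h : x * w = z * y) (hs : s * y = x * t)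
    (hs' : s' * w = z * t')
    (h0 : ¬(s = 0 ∧ t = 0)) (h0' : ¬(s' = 0 ∧ t' = 0)) (hne : qpSig s t ≠ qpSig s' t') :
    ∃ E : Finset F, E.card ≤ 1 ∧ ∀ M : IntermediateField K F, (E : Set F) ⊆ M → qpSig s t ∈ M →
      qpSig s' t' ∈ M → (x ∈ M ∧ y ∈ M) ∧ (z ∈ M ∧ w ∈ M) := by
  classical
  by_cases h1 : x = 0 ∧ y = 0
  · refine ⟨{qpLam z w}, by simp, fun M hM _ hM2 => ?_⟩
    simp at hM
    refine ⟨qp_zero_mem M h1, ?_⟩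
    by_cases h2 : z = 0 ∧ w = 0
    · exact qp_zero_mem M h2
    · exact qp_recon M hM (qp_sig_eq hs' h0' h2 ▸ hM2)
  · refine ⟨{qpLam x y}, by simp, fun M hM hM2 _ => ?_⟩
    simp at hM
    refine ⟨qp_recon M hM (qp_sig_eq hs h0 h1 ▸ hM2), ?_⟩
    by_cases h2 : z = 0 ∧ w = 0
    · exact qp_zero_mem M h2
    · exact absurd ((qp_sig_eq hs h0 h1).trans ((qp_sig_eq h h1 h2).trans
        (qp_sig_eq hs' h0' h2).symm)) hne

lemma qp_combine {ι : Type*} [Fintype ι] (E₀ : Finset F) (c : ℕ)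
    (P : ι → IntermediateField K F → Prop)
    (h : ∀ i, ∃ E : Finset F, E.card ≤ c ∧ ∀ M : IntermediateField K F, (E : Set F) ⊆ M →
      (E₀ : Set F) ⊆ M → P i M) :
    ∃ E : Finset F, E.card ≤ E₀.card + c * Fintype.card ι ∧ ∀ M : IntermediateField K F,
      (E : Set F) ⊆ M → (E₀ : Set F) ⊆ M ∧ ∀ i, P i M := by
  classical
  choose E hE hP using h
  refine ⟨E₀ ∪ Finset.univ.biUnion E, ?_, fun M hM => ?_⟩
  · refine (Finset.card_union_le _ _).trans (Nat.add_le_add_left ?_ _)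
    refine (Finset.card_biUnion_le_card_mul _ _ c fun i _ => hE i).trans ?_
    rw [mul_comm, Finset.card_univ]
  · have h0 : (E₀ : Set F) ⊆ M := fun z hz => hM (by simp at hz ⊢; exact Or.inl hz)
    refine ⟨h0, fun i => hP i M (fun z hz => hM ?_) h0⟩
    simp only [Finset.coe_union, Finset.coe_biUnion, Set.mem_union, Set.mem_iUnion]
    exact Or.inr ⟨i, by simp, hz⟩

lemma qp_gen {ι : Type*} [Fintype ι] (N : ℕ) (x y z w : ι → F) (s t s' t' : F)
    (h : ∀ i, x i * w i = z i * y i) (hs : ∀ i, s * y i = x i * t)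
    (hs' : ∀ i, s' * w i = z i * t')
    (hN1 : 3 * Fintype.card ι ≤ N) (hN2 : 2 * Fintype.card ι + 3 ≤ N)
    (hN3 : Fintype.card ι + 4 ≤ N) :
    ∃ E : Finset F, E.card ≤ N ∧ ∀ M : IntermediateField K F, (E : Set F) ⊆ M →
      (s ∈ M ∧ t ∈ M) ∧ (s' ∈ M ∧ t' ∈ M) ∧
        ∀ i, (x i ∈ M ∧ y i ∈ M) ∧ (z i ∈ M ∧ w i ∈ M) := by
  classical
  by_cases h0 : s = 0 ∧ t = 0
  · by_cases h0' : s' = 0 ∧ t' = 0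
    · obtain ⟨E, hE, hM⟩ := qp_combine (K := K) ∅ 3
        (fun i M => (x i ∈ M ∧ y i ∈ M) ∧ (z i ∈ M ∧ w i ∈ M)) (fun i => by
          obtain ⟨E, hE, hM⟩ := qp_path3 (K := K) (h i)
          exact ⟨E, hE, fun M h1 _ => hM M h1⟩)
      refine ⟨E, hE.trans (by simpa using hN1), fun M hE => ?_⟩
      exact ⟨qp_zero_mem M h0, qp_zero_mem M h0', (hM M hE).2⟩
    · obtain ⟨E, hE, hM⟩ := qp_combine (K := K) {qpLam s' t', qpSig s' t'} 2
        (fun i M => (x i ∈ M ∧ y i ∈ M) ∧ (z i ∈ M ∧ w i ∈ M)) (fun i => by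
          obtain ⟨E, hE, hM⟩ := qp_path2 (K := K) (h i).symm (hs' i) h0'
          refine ⟨E, hE, fun M h1 h2 => (hM M h1 ?_).symm⟩
          simp [Set.insert_subset_iff] at h2
          exact h2.2)
      refine ⟨E, hE.trans ?_, fun M hE => ?_⟩
      · have := Finset.card_le_two (a := qpLam s' t') (b := qpSig s' t')
        omega
      · have h2 := (hM M hE).1
        simp [Set.insert_subset_iff] at h2
        exact ⟨qp_zero_mem M h0, qp_recon M h2.1 h2.2, (hM M hE).2⟩
  · by_cases h0' : s' = 0 ∧ t' = 0
    · obtain ⟨E, hE, hM⟩ := qp_combine (K := K) {qpLam s t, qpSig s t} 2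
        (fun i M => (x i ∈ M ∧ y i ∈ M) ∧ (z i ∈ M ∧ w i ∈ M)) (fun i => by
          obtain ⟨E, hE, hM⟩ := qp_path2 (K := K) (h i) (hs i) h0
          refine ⟨E, hE, fun M h1 h2 => (hM M h1 ?_)⟩
          simp [Set.insert_subset_iff] at h2
          exact h2.2)
      refine ⟨E, hE.trans ?_, fun M hE => ?_⟩
      · have := Finset.card_le_two (a := qpLam s t) (b := qpSig s t)
        omega
      · have h2 := (hM M hE).1
        simp [Set.insert_subset_iff] at h2
        exact ⟨qp_recon M h2.1 h2.2, qp_zero_mem M h0', (hM M hE).2⟩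
    · by_cases hne : qpSig s t = qpSig s' t'
      · obtain ⟨E, hE, hM⟩ := qp_combine (K := K) {qpLam s t, qpLam s' t', qpSig s t} 2
          (fun i M => (x i ∈ M ∧ y i ∈ M) ∧ (z i ∈ M ∧ w i ∈ M)) (fun i => by
            obtain ⟨E, hE, hM⟩ := qp_path2 (K := K) (h i) (hs i) h0
            refine ⟨E, hE, fun M h1 h2 => (hM M h1 ?_)⟩
            simp [Set.insert_subset_iff] at h2
            exact h2.2.2)
        refine ⟨E, hE.trans ?_, fun M hE => ?_⟩
        · have := Finset.card_le_three (a := qpLam s t) (b := qpLam s' t') (c := qpSig s t)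
          omega
        · have h2 := (hM M hE).1
          simp [Set.insert_subset_iff] at h2
          exact ⟨qp_recon M h2.1 h2.2.2, qp_recon M h2.2.1 (hne ▸ h2.2.2), (hM M hE).2⟩
      · obtain ⟨E, hE, hM⟩ := qp_combine (K := K)
          {qpLam s t, qpLam s' t', qpSig s t, qpSig s' t'} 1
          (fun i M => (x i ∈ M ∧ y i ∈ M) ∧ (z i ∈ M ∧ w i ∈ M)) (fun i => by
            obtain ⟨E, hE, hM⟩ := qp_path1 (K := K) (h i) (hs i) (hs' i) h0 h0' hne
            refine ⟨E, hE, fun M h1 h2 => ?_⟩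
            simp [Set.insert_subset_iff] at h2
            exact hM M h1 h2.2.2.1 h2.2.2.2)
        refine ⟨E, hE.trans ?_, fun M hE => ?_⟩
        · have := Finset.card_le_four (a := qpLam s t) (b := qpLam s' t') (c := qpSig s t)
            (d := qpSig s' t')
          omega
        · have h2 := (hM M hE).1
          simp [Set.insert_subset_iff] at h2
          exact ⟨qp_recon M h2.1 h2.2.2.1, qp_recon M h2.2.1 h2.2.2.2, (hM M hE).2⟩

end

lemma qp_adj {k : ℕ} (a i j : Fin k) (h : i = a ∨ j = a ∨ i = j) (h' : ¬(i = a ∧ j = a)) :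
    (quasiPencilGraph k a).Adj (Sum.inl i) (Sum.inr j) := by
  unfold quasiPencilGraph
  rw [SimpleGraph.fromRel_adj]
  exact ⟨by simp, Or.inl ⟨i, j, rfl, rfl, h, h'⟩⟩

lemma qp_card {k : ℕ} (a : Fin k) : Fintype.card {i : Fin k // i ≠ a} = k - 1 := by
  simp [Fintype.card_subtype_compl]

lemma qp_dim_upper {k : ℕ} (a : Fin k) (K : Type u) [Field K] (N : ℕ)
    (hN1 : 3 * (k - 1) ≤ N) (hN2 : 2 * (k - 1) + 3 ≤ N) (hN3 : (k - 1) + 4 ≤ N) :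
    ringKrullDim (MvPolynomial ((Fin k ⊕ Fin k) ⊕ (Fin k ⊕ Fin k)) K ⧸
          binomialEdgeIdeal K (quasiPencilGraph k a)) ≤ N := by
  refine qp_upper _ N fun F _ _ φ hφ => ?_
  have hadj : ∀ u v, (quasiPencilGraph k a).Adj u v →
      φ (X (Sum.inl u)) * φ (X (Sum.inr v)) = φ (X (Sum.inl v)) * φ (X (Sum.inr u)) := by
    intro u v huv
    have := hφ _ (Ideal.subset_span ⟨u, v, huv, rfl⟩)
    rw [map_sub, map_mul, map_mul] at this
    exact sub_eq_zero.1 this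
  obtain ⟨E, hE, hM⟩ := qp_gen (K := K) (ι := {i : Fin k // i ≠ a}) N
    (fun i => φ (X (Sum.inl (Sum.inr i.1)))) (fun i => φ (X (Sum.inr (Sum.inr i.1))))
    (fun i => φ (X (Sum.inl (Sum.inl i.1)))) (fun i => φ (X (Sum.inr (Sum.inl i.1))))
    (φ (X (Sum.inl (Sum.inl a)))) (φ (X (Sum.inr (Sum.inl a))))
    (φ (X (Sum.inl (Sum.inr a)))) (φ (X (Sum.inr (Sum.inr a))))
    (fun i => hadj _ _ (qp_adj a i.1 i.1 (by simp) (fun h => i.2 h.1)).symm)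
    (fun i => hadj _ _ (qp_adj a a i.1 (by simp) (fun h => i.2 h.2)))
    (fun i => hadj _ _ (qp_adj a i.1 a (by simp) (fun h => i.2 h.1)).symm)
    (by rwa [qp_card]) (by rwa [qp_card]) (by rwa [qp_card])
  refine ⟨E, hE, fun M hEM => ?_⟩
  obtain ⟨h1, h2, h3⟩ := hM M hEM
  rintro ((i | i) | (i | i)) <;> by_cases hi : i = a
  · rw [hi]; exact h1.1
  · exact (h3 ⟨i, hi⟩).2.1
  · rw [hi]; exact h2.1
  · exact (h3 ⟨i, hi⟩).1.1
  · rw [hi]; exact h1.2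
  · exact (h3 ⟨i, hi⟩).2.2
  · rw [hi]; exact h2.2
  · exact (h3 ⟨i, hi⟩).1.2

lemma qp_kill {V : Type} {τ : Type} {K : Type u} [Field K] (G : SimpleGraph V)
    (f : V ⊕ V → MvPolynomial τ K)
    (h : ∀ u v, G.Adj u v → f (Sum.inl u) * f (Sum.inr v) = f (Sum.inl v) * f (Sum.inr u)) :
    ∀ x ∈ binomialEdgeIdeal K G, aeval f x = 0 := by
  have : binomialEdgeIdeal K G ≤ RingHom.ker (aeval (R := K) f) := by
    refine Ideal.span_le.2 ?_
    rintro _ ⟨u, v, huv, rfl⟩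
    simp [RingHom.mem_ker, h u v huv]
  exact fun x hx => this hx

lemma qp_dim_lower1 {k : ℕ} (a : Fin k) (K : Type u) [Field K] :
    ((2 * k + 1 : ℕ) : WithBot ℕ∞) ≤
    ringKrullDim (MvPolynomial ((Fin k ⊕ Fin k) ⊕ (Fin k ⊕ Fin k)) K ⧸
          binomialEdgeIdeal K (quasiPencilGraph k a)) := by
  let f : (Fin k ⊕ Fin k) ⊕ (Fin k ⊕ Fin k) → MvPolynomial (Option (Fin k ⊕ Fin k)) K :=
    Sum.elim (fun v => X (some v)) (fun v => X (some v) * X none)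
  have := qp_lower (binomialEdgeIdeal K (quasiPencilGraph k a)) (aeval f)
    (qp_kill _ f (by intro u v _; simp only [f, Sum.elim_inl, Sum.elim_inr]; ring)) (by
      rintro (_ | v)
      · refine ⟨X (Sum.inr (Sum.inl a)), X (Sum.inl (Sum.inl a)), ?_, ?_⟩ <;> simp [f]
      · exact ⟨X (Sum.inl v), 1, by simp, by simp [f]⟩)
  have hc : Fintype.card (Option (Fin k ⊕ Fin k)) = 2 * k + 1 := by simp; ring
  rwa [hc] at this

lemma qp_dim_lower2 {k : ℕ} (a : Fin k) (K : Type u) [Field K] :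
    ((3 * k - 3 : ℕ) : WithBot ℕ∞) ≤
    ringKrullDim (MvPolynomial ((Fin k ⊕ Fin k) ⊕ (Fin k ⊕ Fin k)) K ⧸
          binomialEdgeIdeal K (quasiPencilGraph k a)) := by
  let g (i : Fin k) (j : Fin 3) : MvPolynomial ({i : Fin k // i ≠ a} × Fin 3) K :=
    if h : i ≠ a then X (⟨i, h⟩, j) else 0
  have hg (j : Fin 3) : g a j = 0 := by simp [g]
  let f : (Fin k ⊕ Fin k) ⊕ (Fin k ⊕ Fin k) → MvPolynomial ({i : Fin k // i ≠ a} × Fin 3) K :=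
    Sum.elim (Sum.elim (fun i => g i 0) (fun i => g i 1))
      (Sum.elim (fun i => g i 0 * g i 2) (fun i => g i 1 * g i 2))
  have hrel : ∀ i j : Fin k, (i = a ∨ j = a ∨ i = j) →
      g i 0 * (g j 1 * g j 2) = g j 1 * (g i 0 * g i 2) := by
    rintro i j (rfl | rfl | rfl)
    · simp [hg]
    · simp [hg]
    · ring
  have := qp_lower (binomialEdgeIdeal K (quasiPencilGraph k a)) (aeval f)
    (qp_kill _ f (by
      intro u v huv
      unfold quasiPencilGraph at huv
      rw [SimpleGraph.fromRel_adj] at huv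
      obtain ⟨-, ⟨i, j, rfl, rfl, h, -⟩ | ⟨i, j, rfl, rfl, h, -⟩⟩ := huv
      · exact hrel i j h
      · exact (hrel i j h).symm)) (by
      rintro ⟨⟨i, hi⟩, j⟩
      have hX : ∀ j, g i j = X (⟨i, hi⟩, j) := fun j => by simp [g, hi]
      fin_cases j
      · exact ⟨X (Sum.inl (Sum.inl i)), 1, by simp, by simp [f, hX]⟩
      · exact ⟨X (Sum.inl (Sum.inr i)), 1, by simp, by simp [f, hX]⟩
      · exact ⟨X (Sum.inr (Sum.inl i)), X (Sum.inl (Sum.inl i)), by simp [f, hX],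
          by simp [f, hX]⟩)
  have hc : Fintype.card ({i : Fin k // i ≠ a} × Fin 3) = 3 * k - 3 := by
    rw [Fintype.card_prod, qp_card, Fintype.card_fin]; omega
  rwa [hc] at this

theorem dim_quasiPencilGraph {k : ℕ} (hk : 3 ≤ k) (a : Fin k)
    (K : Type*) [Field K] :
    (k = 3 →
      ringKrullDim (MvPolynomial ((Fin k ⊕ Fin k) ⊕ (Fin k ⊕ Fin k)) K ⧸
          binomialEdgeIdeal K (quasiPencilGraph k a))
        = ((7 : ℕ) : WithBot (WithTop ℕ))) ∧
    (4 ≤ k →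
      ringKrullDim (MvPolynomial ((Fin k ⊕ Fin k) ⊕ (Fin k ⊕ Fin k)) K ⧸
          binomialEdgeIdeal K (quasiPencilGraph k a))
        = ((3 * k - 3 : ℕ) : WithBot (WithTop ℕ))) := by
  constructor
  · rintro rfl
    exact le_antisymm (qp_dim_upper a K 7 (by norm_num) (by norm_num) (by norm_num))
      (qp_dim_lower1 a K)
  · intro h4
    exact le_antisymm (qp_dim_upper a K (3 * k - 3) (by omega) (by omega) (by omega))
      (qp_dim_lower2 a K)
end

section
/- Let G_k (k ≥ 4) be the Levi graph of the Hirzebruch quasi-pencil of k lines, as defined by edges {x_2,y_i} (i ≠ 2), {x_j,y_2} (j ≠ 2), {x_m,y_m} (m ≠ 2). Then S/J_{G_k} is not Cohen–Macaulay, and its Cohen–Macaulay defect satisfies cmdef(S/J_{G_k}) ≥ k − 3. -/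
open MvPolynomial

/-- The depth of `S ⧸ J` with respect to the irrelevant maximal ideal generated by the
variables, defined as the supremum of lengths of regular sequences on `S ⧸ J` consisting of
elements of that ideal. -/
noncomputable def quotDepth {σ : Type*} (K : Type*) [Field K]
    (J : Ideal (MvPolynomial σ K)) : ℕ :=
  sSup {n : ℕ | ∃ rs : List (MvPolynomial σ K), rs.length = n ∧
    (∀ r ∈ rs, r ∈ Ideal.span (Set.range (X : σ → MvPolynomial σ K))) ∧
    RingTheory.Sequence.IsRegular (MvPolynomial σ K ⧸ J) rs}

/-- `S ⧸ J` is Cohen–Macaulay: its Krull dimension equals its depth. -/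
def quotIsCM {σ : Type*} (K : Type*) [Field K] (J : Ideal (MvPolynomial σ K)) : Prop :=
  ringKrullDim (MvPolynomial σ K ⧸ J) = ((quotDepth K J : ℕ) : WithBot (WithTop ℕ))

/-- Elements which, up to a multiplier outside the prime `m`, lie in the span of `w`. -/
def satSpan {R M : Type*} [CommRing R] [AddCommGroup M] [Module R M]
    (m : Ideal R) [hm : m.IsPrime] (w : M) : Submodule R M where
  carrier := {u | ∃ s, s ∉ m ∧ ∃ c : R, s • u = c • w}
  zero_mem' := ⟨1, fun h => hm.ne_top ((Ideal.eq_top_iff_one m).2 h), 0, by simp⟩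
  add_mem' := by
    rintro u v ⟨s, hs, c, h⟩ ⟨t, ht, d, h'⟩
    refine ⟨s * t, fun h => (hm.mem_or_mem h).elim hs ht, t * c + s * d, ?_⟩
    rw [smul_add, mul_comm s t, mul_smul, h, mul_comm t s, mul_smul, h', add_smul, mul_smul,
      mul_smul]
  smul_mem' := by
    rintro r u ⟨s, hs, c, h⟩
    exact ⟨s, hs, r * c, by rw [smul_comm, h, mul_smul]⟩

theorem exists_good_element {R M : Type*} [CommRing R] [IsNoetherianRing R] [AddCommGroup M]
    [Module R M] [Module.Finite R M] (m : Ideal R) [hm : m.IsPrime] (x : R) (hxm : x ∈ m)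
    (hx : IsSMulRegular M x) (z : M) (hz : ∀ r : R, r • z = 0 → r ∈ m) :
    ∃ w : M, (∀ r : R, r • z = 0 → r • w = 0) ∧
      ∀ (r : R) (w' : M), r • w = x • w' → r ∈ m := by
  let A : Set M := {w | (∀ r : R, r • z = 0 → r • w = 0) ∧ ∀ r : R, r • w = 0 → r ∈ m}
  have hA : (satSpan m '' A).Nonempty := ⟨_, z, ⟨fun r h => h, hz⟩, rfl⟩
  obtain ⟨W, ⟨w, ⟨hw1, hw2⟩, rfl⟩, hmax⟩ :=
    WellFounded.has_min (wellFounded_gt : WellFounded ((· > ·) : Submodule R M → _ → Prop)) _ hA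
  refine ⟨w, hw1, ?_⟩
  intro s w' hs
  by_contra hsm
  have hw'A : w' ∈ A := by
    constructor
    · intro r hr
      apply hx
      change x • r • w' = x • (0 : M)
      rw [smul_comm, ← hs, smul_comm, hw1 r hr, smul_zero, smul_zero]
    · intro r hr
      have : (r * s) • w = 0 := by rw [mul_smul, hs, smul_comm, hr, smul_zero]
      exact (hm.mem_or_mem (hw2 _ this)).resolve_right hsm
  have hle : satSpan m w ≤ satSpan m w' := by
    rintro u ⟨t, ht, c, h⟩
    refine ⟨s * t, fun h => (hm.mem_or_mem h).elim hsm ht, c * x, ?_⟩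
    rw [mul_smul, h, smul_comm, hs, mul_smul]
  have hge : satSpan m w' ≤ satSpan m w := by
    by_contra hcon
    exact hmax _ ⟨w', hw'A, rfl⟩ (lt_of_le_not_ge hle hcon)
  have hmem : w' ∈ satSpan m w' :=
    ⟨1, fun h => hm.ne_top ((Ideal.eq_top_iff_one m).2 h), 1, rfl⟩
  obtain ⟨t, ht, c, h⟩ := hge hmem
  have h0 : (t * s - x * c) • w = 0 := by
    rw [sub_smul, mul_smul, hs, mul_smul, ← h, smul_comm, sub_self]
  have h1 := hw2 _ h0
  have h2 : t * s ∈ m := by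
    have := m.add_mem h1 (m.mul_mem_right c hxm)
    simpa using this
  exact (hm.mem_or_mem h2).elim ht hsm

open RingTheory.Sequence Pointwise in
theorem length_le_dim {R : Type*} [CommRing R] [IsNoetherianRing R] (m : Ideal R)
    [hm : m.IsPrime] (rs : List R) : ∀ {M : Type*} [AddCommGroup M]
    [Module R M] [Module.Finite R M] (z : M) (_ : ∀ r : R, r • z = 0 → r ∈ m)
    (_ : ∀ r ∈ rs, r ∈ m) (_ : IsWeaklyRegular M rs),
    ((rs.length : ℕ) : WithBot ℕ∞) ≤ ringKrullDim (R ⧸ Ideal.torsionOf R M z) := by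
  induction rs with
  | nil =>
    intro M _ _ _ z hz _ _
    have : Nontrivial (R ⧸ Ideal.torsionOf R M z) := by
      apply Ideal.Quotient.nontrivial_iff.2
      intro h
      exact hm.ne_top (top_le_iff.1 (h ▸ fun r hr => hz r hr))
    simpa using ringKrullDim_nonneg_of_nontrivial
  | cons x rs ih =>
    intro M _ _ _ z hz hrs hreg
    obtain ⟨hx, hreg'⟩ := (isWeaklyRegular_cons_iff M x rs).1 hreg
    obtain ⟨w, hw1, hw2⟩ := exists_good_element m x (hrs x (by simp)) hx z hz
    let wb : QuotSMulTop x M := Submodule.Quotient.mk w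
    have hker : ∀ r : R, r • wb = 0 → r ∈ m := by
      intro r hr
      have : r • w ∈ x • (⊤ : Submodule R M) := by
        rw [← Submodule.Quotient.mk_eq_zero, Submodule.Quotient.mk_smul]; exact hr
      obtain ⟨w', -, h⟩ := (Submodule.mem_smul_pointwise_iff_exists _ _ _).1 this
      exact hw2 r w' h.symm
    have h1 := ih wb hker (fun r hr => hrs r (by simp [hr])) hreg'
    have hle : Ideal.torsionOf R M z ≤ Ideal.torsionOf R (QuotSMulTop x M) wb := by
      intro r hr
      rw [Ideal.mem_torsionOf_iff] at hr ⊢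
      change r • (Submodule.Quotient.mk w : QuotSMulTop x M) = 0
      rw [← Submodule.Quotient.mk_smul, hw1 r hr, Submodule.Quotient.mk_zero]
    have hxw : x ∈ Ideal.torsionOf R (QuotSMulTop x M) wb := by
      rw [Ideal.mem_torsionOf_iff]
      change x • (Submodule.Quotient.mk w : QuotSMulTop x M) = 0
      rw [← Submodule.Quotient.mk_smul, Submodule.Quotient.mk_eq_zero]
      exact Submodule.smul_mem_pointwise_smul _ _ _ trivial
    have h2 : ringKrullDim (R ⧸ Ideal.torsionOf R (QuotSMulTop x M) wb) + 1
        ≤ ringKrullDim (R ⧸ Ideal.torsionOf R M z) := by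
      refine ringKrullDim_succ_le_of_surjective (Ideal.Quotient.factor hle)
        (Ideal.Quotient.factor_surjective hle) (r := Ideal.Quotient.mk _ x) ?_ ?_
      · rw [mem_nonZeroDivisors_iff_right]
        intro c hc
        obtain ⟨c, rfl⟩ := Ideal.Quotient.mk_surjective c
        rw [← map_mul, Ideal.Quotient.eq_zero_iff_mem, Ideal.mem_torsionOf_iff] at hc
        rw [Ideal.Quotient.eq_zero_iff_mem, Ideal.mem_torsionOf_iff]
        apply hx
        change x • c • z = x • (0 : M)
        rw [smul_zero, ← mul_smul, mul_comm, hc]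
      · rw [Ideal.Quotient.factor_mk]
        exact Ideal.Quotient.eq_zero_iff_mem.2 hxw
    refine le_trans ?_ h2
    rw [List.length_cons]
    push_cast
    gcongr

section
variable {k : ℕ} {a : Fin k} {K : Type*} [Field K]

theorem adj_iff (i j : Fin k) : (quasiPencilGraph k a).Adj (Sum.inl i) (Sum.inr j) ↔
    (i = a ∨ j = a ∨ i = j) ∧ ¬(i = a ∧ j = a) := by
  simp [quasiPencilGraph, SimpleGraph.fromRel_adj]

/-- The binomial of a pair of vertices. -/
noncomputable def bin {V : Type*} (K : Type*) [Field K] (u v : V) : MvPolynomial (V ⊕ V) K :=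
  X (Sum.inl u) * X (Sum.inr v) - X (Sum.inl v) * X (Sum.inr u)

theorem bin_mem {V : Type*} {G : SimpleGraph V} {u v : V} (h : G.Adj u v) :
    bin K u v ∈ binomialEdgeIdeal K G := Ideal.subset_span ⟨u, v, h, rfl⟩

theorem path_mem {V : Type*} {G : SimpleGraph V} {u v w : V} (h : G.Adj w u) (h' : G.Adj w v) :
    X (Sum.inl w) * bin K u v ∈ binomialEdgeIdeal K G ∧
    X (Sum.inr w) * bin K u v ∈ binomialEdgeIdeal K G := by
  have h1 := bin_mem (K := K) h
  have h2 := bin_mem (K := K) h'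
  constructor
  · have := Ideal.sub_mem _ (Ideal.mul_mem_left _ (X (Sum.inl u)) h2)
      (Ideal.mul_mem_left _ (X (Sum.inl v)) h1)
    convert this using 1
    simp only [bin]; ring
  · have := Ideal.sub_mem _ (Ideal.mul_mem_left _ (X (Sum.inr u)) h2)
      (Ideal.mul_mem_left _ (X (Sum.inr v)) h1)
    convert this using 1
    simp only [bin]; ring

/-- To kill the edge ideal it suffices to kill the binomials of the edges `x_i y_j`. -/
theorem edge_le_ker {B : Type*} [CommRing B]
    (φ : MvPolynomial ((Fin k ⊕ Fin k) ⊕ (Fin k ⊕ Fin k)) K →+* B)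
    (h : ∀ i j : Fin k, ((i = a ∨ j = a ∨ i = j) ∧ ¬(i = a ∧ j = a)) →
      φ (bin K (Sum.inl i) (Sum.inr j)) = 0) :
    binomialEdgeIdeal K (quasiPencilGraph k a) ≤ RingHom.ker φ := by
  refine Ideal.span_le.2 ?_
  rintro f ⟨u, v, huv, rfl⟩
  rw [quasiPencilGraph, SimpleGraph.fromRel_adj] at huv
  rcases huv with ⟨-, ⟨i, j, rfl, rfl, hij⟩ | ⟨i, j, rfl, rfl, hij⟩⟩
  · exact h i j hij
  · have := h i j hij
    simp only [bin, map_sub, map_mul] at this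
    change φ _ = 0
    simp only [map_sub, map_mul]
    linear_combination -this

/-- The specialised coordinates used for the chain of primes. -/
noncomputable def zc (K : Type*) [Field K] (i n : ℕ) : MvPolynomial ℕ K :=
  if i ≤ n then X n else 0

/-- The value of the coordinates of the vertices at stage `i`. -/
noncomputable def pt (K : Type*) [Field K] (a : Fin k) (e : {m : Fin k // m ≠ a} ≃ Fin (k - 1))
    (i : ℕ) : (Fin k ⊕ Fin k) ⊕ (Fin k ⊕ Fin k) → MvPolynomial ℕ K
  | Sum.inl (Sum.inl m) =>
    if h : m ≠ a then zc K i (3 * (e ⟨m, h⟩ : ℕ)) * zc K i (3 * (e ⟨m, h⟩ : ℕ) + 1) else 0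
  | Sum.inr (Sum.inl m) =>
    if h : m ≠ a then zc K i (3 * (e ⟨m, h⟩ : ℕ)) * zc K i (3 * (e ⟨m, h⟩ : ℕ) + 2) else 0
  | Sum.inl (Sum.inr m) => if h : m ≠ a then zc K i (3 * (e ⟨m, h⟩ : ℕ) + 1) else 0
  | Sum.inr (Sum.inr m) => if h : m ≠ a then zc K i (3 * (e ⟨m, h⟩ : ℕ) + 2) else 0

theorem aeval_zc {i j : ℕ} (hij : i ≤ j) (n : ℕ) :
    aeval (R := K) (zc K j) (zc K i n) = zc K j n := by
  unfold zc
  split_ifs with h1 h2 h2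
  · simp [h2]
  · simp [h2]
  · omega
  · simp

theorem aeval_pt (e : {m : Fin k // m ≠ a} ≃ Fin (k - 1)) {i j : ℕ} (hij : i ≤ j) (v) :
    aeval (R := K) (zc K j) (pt K a e i v) = pt K a e j v := by
  rcases v with (v | v) | (v | v) <;> simp only [pt] <;> split_ifs <;>
    simp only [map_mul, map_zero, aeval_zc hij]

theorem pt_kills (e : {m : Fin k // m ≠ a} ≃ Fin (k - 1)) (i : ℕ) :
    binomialEdgeIdeal K (quasiPencilGraph k a) ≤
      RingHom.ker (aeval (R := K) (pt K a e i)).toRingHom := by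
  apply edge_le_ker
  rintro p q ⟨h1, h2⟩
  by_cases hp : p = a
  · subst hp; simp [bin, pt]
  by_cases hq : q = a
  · subst hq; simp [bin, pt]
  have : p = q := by tauto
  subst this
  simp [bin, pt, hp]
  ring

theorem dim_ge (hk : 4 ≤ k) (a : Fin k) (K : Type*) [Field K] :
    ((3 * (k - 1) : ℕ) : WithBot ℕ∞) ≤
      ringKrullDim (MvPolynomial ((Fin k ⊕ Fin k) ⊕ (Fin k ⊕ Fin k)) K ⧸
          binomialEdgeIdeal K (quasiPencilGraph k a)) := by
  have hcard : Fintype.card {m : Fin k // m ≠ a} = k - 1 := by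
    simp [Fintype.card_subtype_compl]
  let e := Fintype.equivFinOfCardEq hcard
  let ψ : ℕ → (MvPolynomial ((Fin k ⊕ Fin k) ⊕ (Fin k ⊕ Fin k)) K ⧸
      binomialEdgeIdeal K (quasiPencilGraph k a)) →+* MvPolynomial ℕ K := fun i =>
    Ideal.Quotient.lift _ (aeval (R := K) (pt K a e i)).toRingHom (pt_kills e i)
  have hψ : ∀ i v, ψ i (Ideal.Quotient.mk _ (X v)) = pt K a e i v := by
    intro i v
    simp [ψ]
  have hcomp : ∀ i, ψ (i + 1) = (aeval (R := K) (zc K (i + 1))).toRingHom.comp (ψ i) := by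
    intro i
    apply Ideal.Quotient.ringHom_ext
    apply MvPolynomial.ringHom_ext
    · intro r; simp [ψ]
    · intro v
      simp only [RingHom.comp_apply, hψ]
      exact (aeval_pt e (Nat.le_succ i) v).symm
  let P : ℕ → PrimeSpectrum (MvPolynomial ((Fin k ⊕ Fin k) ⊕ (Fin k ⊕ Fin k)) K ⧸
      binomialEdgeIdeal K (quasiPencilGraph k a)) := fun i =>
    ⟨RingHom.ker (ψ i), RingHom.ker_isPrime _⟩
  have hlt : ∀ i, i < 3 * (k - 1) → P i < P (i + 1) := by
    intro i hi
    rw [← PrimeSpectrum.asIdeal_lt_asIdeal]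
    refine lt_of_le_not_ge ?_ ?_
    · intro r hr
      change ψ (i + 1) r = 0
      have hr : ψ i r = 0 := hr
      rw [hcomp, RingHom.comp_apply, hr, map_zero]
    · suffices h : ∃ v, pt K a e (i + 1) v = 0 ∧ pt K a e i v ≠ 0 by
        obtain ⟨v, h1, h2⟩ := h
        intro hle
        have : Ideal.Quotient.mk _ (X v) ∈ (P (i + 1)).asIdeal := by
          change ψ (i + 1) _ = 0
          rw [hψ, h1]
        have h3 : ψ i _ = 0 := hle this
        rw [hψ] at h3
        exact h2 h3
      let q : Fin (k - 1) := ⟨i / 3, by omega⟩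
      obtain ⟨⟨m, hm⟩, hq⟩ := e.surjective q
      have hq' : ((e ⟨m, hm⟩ : Fin (k - 1)) : ℕ) = i / 3 := by rw [hq]
      have hr : i % 3 = 0 ∨ i % 3 = 1 ∨ i % 3 = 2 := by omega
      rcases hr with hr | hr | hr
      · refine ⟨Sum.inl (Sum.inl m), ?_⟩
        simp only [pt, dif_pos hm, hq', zc]
        rw [if_neg (show ¬ i + 1 ≤ 3 * (i / 3) by omega), if_pos (show i ≤ 3 * (i / 3) by omega),
          if_pos (show i ≤ 3 * (i / 3) + 1 by omega)]
        exact ⟨zero_mul _, mul_ne_zero (X_ne_zero _) (X_ne_zero _)⟩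
      · refine ⟨Sum.inl (Sum.inr m), ?_⟩
        simp only [pt, dif_pos hm, hq', zc]
        rw [if_neg (by omega), if_pos (by omega)]
        simp
      · refine ⟨Sum.inr (Sum.inr m), ?_⟩
        simp only [pt, dif_pos hm, hq', zc]
        rw [if_neg (by omega), if_pos (by omega)]
        simp
  have hmono : StrictMono (fun i : Fin (3 * (k - 1) + 1) => P i) := by
    rw [Fin.strictMono_iff_lt_succ]
    intro i
    simpa using hlt i i.2
  exact Order.LTSeries.length_le_krullDim (LTSeries.mk _ _ hmono)

theorem depth_le (hk : 4 ≤ k) (a : Fin k) (K : Type*) [Field K] :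
    quotDepth K (binomialEdgeIdeal K (quasiPencilGraph k a)) ≤ 2 * k := by
  apply csSup_le'
  rintro n ⟨rs, rfl, hrs, hreg⟩
  -- two further indices
  obtain ⟨b, hb⟩ : ∃ b : Fin k, b ≠ a := by
    have : Nontrivial (Fin k) := Fin.nontrivial_iff_two_le.2 (by omega)
    exact exists_ne a
  obtain ⟨c, hc⟩ : ∃ c : Fin k, c ∉ ({a, b} : Finset (Fin k)) := by
    by_contra! h
    have h1 : (Finset.univ : Finset (Fin k)) ⊆ {a, b} := fun x _ => h x
    have h2 := Finset.card_le_card h1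
    have h3 := Finset.card_le_two (a := a) (b := b)
    simp at h2
    omega
  simp only [Finset.mem_insert, Finset.mem_singleton, not_or] at hc
  obtain ⟨hca, hcb⟩ := hc
  set J := binomialEdgeIdeal K (quasiPencilGraph k a) with hJ
  let f : MvPolynomial ((Fin k ⊕ Fin k) ⊕ (Fin k ⊕ Fin k)) K :=
    bin K (Sum.inr b) (Sum.inr c) *
      ∏ j ∈ Finset.univ.erase a, bin K (Sum.inr j) (Sum.inr a)
  -- the `x`-variables are killed by `f`
  have hkill : ∀ i : Fin k, X (Sum.inl (Sum.inl i)) * f ∈ J ∧ X (Sum.inr (Sum.inl i)) * f ∈ J := by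
    intro i
    by_cases hi : i = a
    · subst hi
      have := path_mem (K := K) (G := quasiPencilGraph k i) (w := Sum.inl i)
        (u := Sum.inr b) (v := Sum.inr c) ((adj_iff _ _).2 (by tauto)) ((adj_iff _ _).2 (by tauto))
      simp only [f, ← mul_assoc]
      exact ⟨Ideal.mul_mem_right _ _ this.1, Ideal.mul_mem_right _ _ this.2⟩
    · have := path_mem (K := K) (G := quasiPencilGraph k a) (w := Sum.inl i)
        (u := Sum.inr i) (v := Sum.inr a) ((adj_iff _ _).2 (by tauto)) ((adj_iff _ _).2 (by tauto))
      have hdvd : bin K (Sum.inr i) (Sum.inr a) ∣ f :=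
        Dvd.dvd.mul_left (Finset.dvd_prod_of_mem
          (fun j : Fin k => bin K (Sum.inr j : Fin k ⊕ Fin k) (Sum.inr a)) (by simp [hi])) _
      obtain ⟨g, hg⟩ := hdvd
      rw [hg, ← mul_assoc, ← mul_assoc]
      exact ⟨Ideal.mul_mem_right _ _ this.1, Ideal.mul_mem_right _ _ this.2⟩
  -- a curve through the origin on which `J` vanishes and `f` does not
  let p : (Fin k ⊕ Fin k) ⊕ (Fin k ⊕ Fin k) → Polynomial K
    | Sum.inl (Sum.inl _) => 0
    | Sum.inr (Sum.inl _) => 0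
    | Sum.inl (Sum.inr j) => if j = a ∨ j = b then Polynomial.X else 0
    | Sum.inr (Sum.inr j) => if j = a then 0 else Polynomial.X
  let φ := (aeval (R := K) p).toRingHom
  have hφJ : J ≤ RingHom.ker φ := by
    apply edge_le_ker
    intro i j _
    simp [φ, bin, p]
  have hφf : φ f ≠ 0 := by
    have h1 : ∀ j : Fin k, j ≠ a → φ (bin K (Sum.inr j) (Sum.inr a)) ≠ 0 := by
      intro j hj
      simp [φ, bin, p, hj]
    have h2 : φ (bin K (Sum.inr b) (Sum.inr c)) ≠ 0 := by
      simp [φ, bin, p, hb, hca, hcb]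
    simp only [f, map_mul, map_prod]
    refine mul_ne_zero h2 (Finset.prod_ne_zero_iff.2 ?_)
    intro j hj
    exact h1 j (by simpa using hj)
  -- the irrelevant maximal ideal
  let m : Ideal (MvPolynomial ((Fin k ⊕ Fin k) ⊕ (Fin k ⊕ Fin k)) K) :=
    RingHom.ker (constantCoeff (R := K))
  have hm : m.IsPrime := RingHom.ker_isPrime _
  have hspan : Ideal.span (Set.range
      (X : _ → MvPolynomial ((Fin k ⊕ Fin k) ⊕ (Fin k ⊕ Fin k)) K)) ≤ m := by
    refine Ideal.span_le.2 ?_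
    rintro _ ⟨v, rfl⟩
    simp [m, RingHom.mem_ker]
  let z : MvPolynomial ((Fin k ⊕ Fin k) ⊕ (Fin k ⊕ Fin k)) K ⧸ J := Ideal.Quotient.mk J f
  have hz0 : ∀ r : MvPolynomial ((Fin k ⊕ Fin k) ⊕ (Fin k ⊕ Fin k)) K,
      r • z = 0 ↔ r * f ∈ J := by
    intro r
    rw [← Ideal.Quotient.eq_zero_iff_mem]
    exact Iff.rfl
  have hz : ∀ r : MvPolynomial ((Fin k ⊕ Fin k) ⊕ (Fin k ⊕ Fin k)) K,
      r • z = 0 → r ∈ m := by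
    intro r hr
    have h1 : φ (r * f) = 0 := hφJ ((hz0 r).1 hr)
    rw [map_mul] at h1
    have h2 : φ r = 0 := (mul_eq_zero.1 h1).resolve_right hφf
    have h3 : (Polynomial.constantCoeff.comp φ) = constantCoeff (R := K) := by
      apply MvPolynomial.ringHom_ext
      · intro r; simp [φ]
      · rintro ((v | v) | (v | v)) <;> simp [φ, p] <;> split_ifs <;> simp
    change constantCoeff r = 0
    rw [← h3, RingHom.comp_apply, h2, map_zero]
  have hmain := length_le_dim m rs z hz (fun r hr => hspan (hrs r hr)) hreg.toIsWeaklyRegular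
  -- the quotient by the colon ideal is a quotient of a polynomial ring in `2k` variables
  set I := Ideal.torsionOf (MvPolynomial ((Fin k ⊕ Fin k) ⊕ (Fin k ⊕ Fin k)) K) _ z with hI
  let g : MvPolynomial (Fin k ⊕ Fin k) K →ₐ[K]
      (MvPolynomial ((Fin k ⊕ Fin k) ⊕ (Fin k ⊕ Fin k)) K ⧸ I) :=
    (Ideal.Quotient.mkₐ K I).comp (rename (Sum.map Sum.inr Sum.inr))
  have hg : Function.Surjective g := by
    rw [← AlgHom.range_eq_top, eq_top_iff]
    have h1 : (⊤ : Subalgebra K (MvPolynomial ((Fin k ⊕ Fin k) ⊕ (Fin k ⊕ Fin k)) K ⧸ I)) =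
        (Algebra.adjoin K (Set.range X)).map (Ideal.Quotient.mkₐ K I) := by
      rw [MvPolynomial.adjoin_range_X, Algebra.map_top, eq_comm, AlgHom.range_eq_top]
      exact Ideal.Quotient.mkₐ_surjective K I
    rw [h1, AlgHom.map_adjoin, Algebra.adjoin_le_iff]
    rintro _ ⟨_, ⟨v, rfl⟩, rfl⟩
    rcases v with (v | v) | (v | v)
    · refine ⟨0, ?_⟩
      rw [map_zero, eq_comm]
      exact Ideal.Quotient.eq_zero_iff_mem.2 ((hz0 _).2 (hkill v).1)
    · exact ⟨X (Sum.inl v), by simp [g]⟩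
    · refine ⟨0, ?_⟩
      rw [map_zero, eq_comm]
      exact Ideal.Quotient.eq_zero_iff_mem.2 ((hz0 _).2 (hkill v).2)
    · exact ⟨X (Sum.inr v), by simp [g]⟩
  have hdim := ringKrullDim_le_of_surjective g.toRingHom hg
  rw [MvPolynomial.ringKrullDim_of_isNoetherianRing, ringKrullDim_eq_zero_of_field] at hdim
  have := hmain.trans hdim
  rw [zero_add] at this
  have h4 : rs.length ≤ Nat.card (Fin k ⊕ Fin k) := by exact_mod_cast this
  simp at h4
  omega

end

theorem quasiPencilGraph_not_CM {k : ℕ} (hk : 4 ≤ k) (a : Fin k)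
    (K : Type*) [Field K] :
    ¬ quotIsCM K (binomialEdgeIdeal K (quasiPencilGraph k a)) ∧
    ((quotDepth K (binomialEdgeIdeal K (quasiPencilGraph k a)) + (k - 3) : ℕ) :
        WithBot (WithTop ℕ))
      ≤ ringKrullDim (MvPolynomial ((Fin k ⊕ Fin k) ⊕ (Fin k ⊕ Fin k)) K ⧸
          binomialEdgeIdeal K (quasiPencilGraph k a)) := by
  have h1 := dim_ge hk a K
  have h2 := depth_le hk a K
  have h3 : ((quotDepth K (binomialEdgeIdeal K (quasiPencilGraph k a)) + (k - 3) : ℕ) :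
        WithBot (WithTop ℕ))
      ≤ ringKrullDim (MvPolynomial ((Fin k ⊕ Fin k) ⊕ (Fin k ⊕ Fin k)) K ⧸
          binomialEdgeIdeal K (quasiPencilGraph k a)) := by
    refine le_trans ?_ h1
    have : quotDepth K (binomialEdgeIdeal K (quasiPencilGraph k a)) + (k - 3) ≤ 3 * (k - 1) := by
      omega
    exact (Nat.cast_le (α := WithBot ℕ∞)).2 this
  refine ⟨fun h => ?_, h3⟩
  rw [quotIsCM] at h
  rw [h] at h3
  have h4 : quotDepth K (binomialEdgeIdeal K (quasiPencilGraph k a)) + (k - 3) ≤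
      quotDepth K (binomialEdgeIdeal K (quasiPencilGraph k a)) := by exact_mod_cast h3
  omega
end

section
/- Let CL = {ℓ_1,...,ℓ_n, C_1,...,C_k} be a conic-line arrangement in ℂP² with only ordinary singularities, n ≥ 1 lines and k ≥ 1 conics, and H its Levi graph. Then every vertex of H has degree at least 2 (every line and every conic contains at least two singular points, and every singular point lies on at least two curves); consequently S_H/J_H is never Cohen–Macaulay. -/
open MvPolynomial

/-- The Levi graph of an arrangement of curves `C : ι → Set P` with singular points `S`:
the bipartite incidence graph between singular points and curves. -/
def leviGraph {P ι : Type*} (C : ι → Set P) (S : Finset P) :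
    SimpleGraph ({p // p ∈ S} ⊕ ι) :=
  SimpleGraph.fromRel (fun u v => ∃ (p : {p // p ∈ S}) (i : ι),
    u = Sum.inl p ∧ v = Sum.inr i ∧ (p : P) ∈ C i)

section Helpers

/-- Going up one step along a regular element inside a prime `m`. -/
lemma exists_assoc_quotSMulTop {R : Type*} [CommRing R] [IsNoetherianRing R]
    {M : Type*} [AddCommGroup M] [Module R M] [Module.Finite R M]
    (m : Ideal R) [hm : m.IsPrime] (P : Ideal R) (hP : P ∈ associatedPrimes R M) (hPm : P ≤ m)
    (x : R) (hxm : x ∈ m) (hx : IsSMulRegular M x) :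
    ∃ Q ∈ associatedPrimes R (QuotSMulTop x M), P ≤ Q ∧ x ∈ Q ∧ Q ≤ m := by
  have hP' := isAssociatedPrime_iff.1 hP
  obtain ⟨hPp, y0, hy0⟩ := hP'
  let N : Submodule R M := Submodule.torsionBySet R M (P : Set R)
  have hN : ∀ y, y ∈ N ↔ ∀ p ∈ P, p • y = 0 := by
    intro y
    simp [N, Submodule.mem_torsionBySet_iff]
  have hy0N : y0 ∈ N := by
    rw [hN]
    intro p hp
    rw [hy0, Submodule.mem_colon_singleton] at hp
    simpa using hp
  let N' : Submodule R (QuotSMulTop x M) := N.map (Submodule.mkQ _)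
  have hPN' : P ≤ Module.annihilator R N' := by
    intro p hp
    rw [Module.mem_annihilator]
    rintro ⟨_, y, hy, rfl⟩
    ext
    have := (hN y).1 hy p hp
    simp only [Submodule.coe_smul, ← map_smul, this, map_zero, Submodule.coe_zero]
  have hxN' : x ∈ Module.annihilator R N' := by
    rw [Module.mem_annihilator]
    rintro ⟨_, y, hy, rfl⟩
    ext
    simp only [Submodule.coe_smul, ← map_smul, Submodule.coe_zero]
    rw [Submodule.mkQ_apply, Submodule.Quotient.mk_eq_zero]
    exact Submodule.smul_mem_pointwise_smul y x ⊤ trivial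
  have hann : Module.annihilator R N' ≤ m := by
    intro r hr
    rw [Module.mem_annihilator] at hr
    have key : ∀ y ∈ N, ∃ z ∈ N, r • y = x • z := by
      intro y hy
      have h1 := congrArg Subtype.val (hr ⟨Submodule.mkQ _ y, y, hy, rfl⟩)
      simp only [Submodule.coe_smul, ← map_smul, Submodule.coe_zero] at h1
      rw [Submodule.mkQ_apply, Submodule.Quotient.mk_eq_zero] at h1
      obtain ⟨z, -, hz⟩ := (Submodule.mem_smul_pointwise_iff_exists _ _ _).1 h1
      refine ⟨z, ?_, hz.symm⟩
      rw [hN]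
      intro p hp
      apply hx
      have := (hN y).1 hy p hp
      change x • p • z = x • (0 : M)
      rw [smul_comm, hz, smul_comm, this, smul_zero, smul_zero]
    obtain ⟨p, hpm, -, hpc, hp0⟩ :=
      LinearMap.exists_monic_and_natDegree_eq_and_coeff_mem_pow_and_aeval_eq_zero R
        (algebraMap R (Module.End R N) r) (Ideal.span {x}) (by
          rintro _ ⟨⟨y, hy⟩, rfl⟩
          obtain ⟨z, hz, hyz⟩ := key y hy
          have : (algebraMap R (Module.End R N) r) ⟨y, hy⟩ = x • (⟨z, hz⟩ : N) := by
            ext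
            simpa using hyz
          rw [this]
          exact Submodule.smul_mem_smul (Ideal.mem_span_singleton_self x) trivial)
    have hpr : p.eval r ∈ P := by
      rw [Polynomial.aeval_algebraMap_apply, ] at hp0
      have := congrArg Subtype.val (LinearMap.congr_fun hp0 ⟨y0, hy0N⟩)
      rw [hy0, Submodule.mem_colon_singleton]
      simpa using this
    have h2 : p.eval r ∈ m := hPm hpr
    rw [Polynomial.eval_eq_sum_range, Finset.sum_range_succ] at h2
    have h3 : ∑ i ∈ Finset.range p.natDegree, p.coeff i * r ^ i ∈ m := by
      refine Ideal.sum_mem _ fun i hi => Ideal.mul_mem_right _ _ ?_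
      have hi' := Finset.mem_range.1 hi
      have h4 := Ideal.pow_le_self (I := Ideal.span {x}) (n := p.natDegree - i) (by omega) (hpc i)
      exact (Ideal.span_singleton_le_iff_mem m).2 hxm h4
    have h5 := (Ideal.add_mem_iff_right m h3).1 h2
    rw [Polynomial.Monic.coeff_natDegree hpm, one_mul] at h5
    exact hm.mem_of_pow_mem _ h5
  obtain ⟨Q, hQ, hQm⟩ := Ideal.exists_minimalPrimes_le hann
  refine ⟨Q, ?_, hPN'.trans hQ.1.2, hQ.1.2 hxN', hQm⟩
  have hQ' := Module.associatedPrimes.minimalPrimes_annihilator_subset_associatedPrimes R N' hQ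
  exact associatedPrimes.subset_of_injective (f := N'.subtype) N'.injective_subtype hQ'

/-- A regular sequence inside a prime `m` is no longer than `dim R/P` for an associated prime
`P ≤ m`. -/
lemma length_le_ringKrullDim {R : Type*} [CommRing R] [IsNoetherianRing R]
    (m : Ideal R) [hm : m.IsPrime] (rs : List R) : ∀ (M : Type*) [AddCommGroup M] [Module R M]
    [Module.Finite R M] (P : Ideal R) (_ : P ∈ associatedPrimes R M) (_ : P ≤ m)
    (_ : ∀ r ∈ rs, r ∈ m) (_ : RingTheory.Sequence.IsWeaklyRegular M rs),
    (rs.length : WithBot ℕ∞) ≤ ringKrullDim (R ⧸ P) := by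
  induction rs with
  | nil =>
    intro M _ _ _ P hP hPm _ _
    have : Nontrivial (R ⧸ P) := Ideal.Quotient.nontrivial_iff.2 hP.isPrime.ne_top
    simpa using ringKrullDim_nonneg_of_nontrivial (R := R ⧸ P)
  | cons x rs ih =>
    intro M _ _ _ P hP hPm hrs hreg
    rw [RingTheory.Sequence.isWeaklyRegular_cons_iff] at hreg
    obtain ⟨Q, hQ, hPQ, hxQ, hQm⟩ := exists_assoc_quotSMulTop m P hP hPm x
      (hrs x (by simp)) hreg.1
    have h1 := ih (QuotSMulTop x M) Q hQ hQm (fun r hr => hrs r (by simp [hr])) hreg.2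
    have hxP : x ∉ P := by
      obtain ⟨hPp, y0, hy0⟩ := isAssociatedPrime_iff.1 hP
      intro hxP
      have hx2 := hxP
      rw [hy0, Submodule.mem_colon_singleton] at hx2
      have hy : y0 = 0 := by
        apply hreg.1
        simpa using hx2
      apply hPp.ne_top
      rw [hy0, hy]
      ext; simp [Submodule.mem_colon_singleton]
    have : IsDomain (R ⧸ P) := by
      have := hP.isPrime
      infer_instance
    have h2 : ringKrullDim (R ⧸ Q) + 1 ≤ ringKrullDim (R ⧸ P) := by
      refine ringKrullDim_succ_le_of_surjective (Ideal.Quotient.factor hPQ)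
        (Ideal.Quotient.factor_surjective hPQ) (r := Ideal.Quotient.mk P x) ?_ ?_
      · rw [mem_nonZeroDivisors_iff_ne_zero]
        rwa [Ne, Ideal.Quotient.eq_zero_iff_mem]
      · simpa [Ideal.Quotient.eq_zero_iff_mem] using hxQ
    refine le_trans ?_ h2
    push_cast [List.length_cons]
    gcongr

/-- The generic component gives `dim S/J ≥ |V| + 1`. -/
lemma card_succ_le_dim {V : Type*} [Finite V] [Nonempty V] (K : Type*) [Field K]
    (G : SimpleGraph V) :
    ((Nat.card V + 1 : ℕ) : WithBot ℕ∞) ≤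
      ringKrullDim (MvPolynomial (V ⊕ V) K ⧸ binomialEdgeIdeal K G) := by
  let φ : MvPolynomial (V ⊕ V) K →ₐ[K] MvPolynomial (V ⊕ Bool) K :=
    aeval (Sum.elim (fun v => X (Sum.inr true) * X (Sum.inl v))
      (fun v => X (Sum.inr false) * X (Sum.inl v)))
  let τ : MvPolynomial (V ⊕ Bool) K →ₐ[K] MvPolynomial V K :=
    aeval (Sum.elim X (fun b => if b then 0 else 1))
  let g : MvPolynomial (V ⊕ V) K →ₐ[K] MvPolynomial V K := τ.comp φ
  have hgy : ∀ v, g (X (Sum.inr v)) = X v := by intro v; simp [g, φ, τ]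
  have hgx : ∀ v, g (X (Sum.inl v)) = 0 := by intro v; simp [g, φ, τ]
  let P := RingHom.ker φ.toRingHom
  have hPp : P.IsPrime := RingHom.ker_isPrime _
  have hJP : binomialEdgeIdeal K G ≤ P := by
    refine Ideal.span_le.2 ?_
    rintro _ ⟨u, v, -, rfl⟩
    change φ _ = 0
    simp [φ]
    ring
  have hPg : P ≤ RingHom.ker g.toRingHom := by
    intro f hf
    change τ (φ f) = 0
    have : φ f = 0 := hf
    rw [this, map_zero]
  obtain ⟨w⟩ := ‹Nonempty V›
  have hgs : Function.Surjective g := by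
    have : g.comp (rename Sum.inr) = AlgHom.id K _ := by
      ext v
      simp [hgy]
    intro f
    exact ⟨rename Sum.inr f, AlgHom.congr_fun this f⟩
  have h1 : ringKrullDim (MvPolynomial V K) + 1 ≤ ringKrullDim (MvPolynomial (V ⊕ V) K ⧸ P) := by
    refine ringKrullDim_succ_le_of_surjective (Ideal.Quotient.lift P g.toRingHom
      (fun a ha => RingHom.mem_ker.1 (hPg ha))) (Ideal.Quotient.lift_surjective_of_surjective _ _ hgs)
      (r := Ideal.Quotient.mk P (X (Sum.inl w))) ?_ ?_
    · rw [mem_nonZeroDivisors_iff_ne_zero, Ne, Ideal.Quotient.eq_zero_iff_mem]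
      intro h
      have : φ (X (Sum.inl w)) = 0 := h
      simp [φ] at this
    · exact hgx w
  have h2 := ringKrullDim_le_of_surjective _ (Ideal.Quotient.factor_surjective hJP)
  refine le_trans (le_of_eq ?_) (h1.trans h2)
  rw [MvPolynomial.ringKrullDim_of_isNoetherianRing, ringKrullDim_eq_zero_of_field]
  simp

/-- If `A` is a vertex cover each of whose vertices has two neighbours outside `A`, then the
depth is at most `2 |V \ A|`. -/
lemma length_le_of_cover {V : Type*} [Finite V] (K : Type*) [Field K]
    (G : SimpleGraph V) (A : Set V) (hcov : ∀ u v, G.Adj u v → u ∈ A ∨ v ∈ A)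
    (hdeg : ∀ v ∈ A, ∃ a b, a ≠ b ∧ a ∉ A ∧ b ∉ A ∧ G.Adj v a ∧ G.Adj v b)
    (rs : List (MvPolynomial (V ⊕ V) K))
    (hrs : ∀ r ∈ rs, r ∈ Ideal.span (Set.range (X : V ⊕ V → MvPolynomial (V ⊕ V) K)))
    (hreg : RingTheory.Sequence.IsRegular
      (MvPolynomial (V ⊕ V) K ⧸ binomialEdgeIdeal K G) rs) :
    rs.length ≤ 2 * Nat.card {v // v ∉ A} := by
  classical
  let B := {v // v ∉ A}
  let ι : B ⊕ B → V ⊕ V := Sum.map Subtype.val Subtype.val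
  have hι : Function.Injective ι := Subtype.val_injective.sumMap Subtype.val_injective
  let ψ : MvPolynomial (V ⊕ V) K →ₐ[K] MvPolynomial (B ⊕ B) K :=
    aeval (Sum.elim (fun v => if h : v ∉ A then X (Sum.inl ⟨v, h⟩) else 0)
      (fun v => if h : v ∉ A then X (Sum.inr ⟨v, h⟩) else 0))
  have hψl : ∀ v, v ∈ A → ψ (X (Sum.inl v)) = 0 := by
    intro v hv; simp [ψ, hv]
  have hψr : ∀ v, v ∈ A → ψ (X (Sum.inr v)) = 0 := by
    intro v hv; simp [ψ, hv]
  have hψl' : ∀ v (h : v ∉ A), ψ (X (Sum.inl v)) = X (Sum.inl ⟨v, h⟩) := by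
    intro v hv; simp [ψ, hv]
  have hψr' : ∀ v (h : v ∉ A), ψ (X (Sum.inr v)) = X (Sum.inr ⟨v, h⟩) := by
    intro v hv; simp [ψ, hv]
  have hψs : Function.Surjective ψ := by
    have : ψ.comp (rename ι) = AlgHom.id K _ := by
      apply MvPolynomial.algHom_ext
      rintro (⟨v, hv⟩ | ⟨v, hv⟩)
      · simp [ι, hψl' v hv]
      · simp [ι, hψr' v hv]
    intro f
    exact ⟨rename ι f, AlgHom.congr_fun this f⟩
  let P := RingHom.ker ψ.toRingHom
  have hPp : P.IsPrime := RingHom.ker_isPrime _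
  have hmemP : ∀ f, f ∈ P ↔ ψ f = 0 := fun f => Iff.rfl
  have hJP : binomialEdgeIdeal K G ≤ P := by
    refine Ideal.span_le.2 ?_
    rintro _ ⟨u, v, huv, rfl⟩
    change ψ _ = 0
    rcases hcov u v huv with h | h
    · simp [hψl u h, hψr u h]
    · simp [hψl v h, hψr v h]
  have hPmin : P ∈ (binomialEdgeIdeal K G).minimalPrimes := by
    refine ⟨⟨hPp, hJP⟩, ?_⟩
    rintro Q ⟨hQp, hJQ⟩ hQP
    have hvar : ∀ v ∈ A, X (Sum.inl v) ∈ Q ∧ X (Sum.inr v) ∈ Q := by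
      intro v hv
      obtain ⟨a, b, hab, ha, hb, hva, hvb⟩ := hdeg v hv
      have e1 : X (Sum.inl v) * X (Sum.inr a) - X (Sum.inl a) * X (Sum.inr v) ∈ Q :=
        hJQ (Ideal.subset_span ⟨v, a, hva, rfl⟩)
      have e2 : X (Sum.inl v) * X (Sum.inr b) - X (Sum.inl b) * X (Sum.inr v) ∈ Q :=
        hJQ (Ideal.subset_span ⟨v, b, hvb, rfl⟩)
      have hD : (X (Sum.inl b) * X (Sum.inr a) - X (Sum.inl a) * X (Sum.inr b) :
          MvPolynomial (V ⊕ V) K) ∉ Q := by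
        intro h
        have h' := (hmemP _).1 (hQP h)
        rw [map_sub, map_mul, map_mul, hψl' b hb, hψr' a ha, hψl' a ha, hψr' b hb] at h'
        have h3 := congrArg (MvPolynomial.eval (Sum.elim
          (fun w : B => if w.1 = b then (1 : K) else 0) (fun w : B => if w.1 = a then 1 else 0))) h'
        simp [hab] at h3
      constructor
      · refine (hQp.mem_or_mem (y := X (Sum.inl b) * X (Sum.inr a) -
          X (Sum.inl a) * X (Sum.inr b)) ?_).resolve_right hD
        have := Q.sub_mem (Q.mul_mem_left (X (Sum.inl b)) e1) (Q.mul_mem_left (X (Sum.inl a)) e2)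
        convert this using 1
        ring
      · refine (hQp.mem_or_mem (y := X (Sum.inl b) * X (Sum.inr a) -
          X (Sum.inl a) * X (Sum.inr b)) ?_).resolve_right hD
        have := Q.sub_mem (Q.mul_mem_left (X (Sum.inr b)) e1) (Q.mul_mem_left (X (Sum.inr a)) e2)
        convert this using 1
        ring
    have hcomp : (Ideal.Quotient.mkₐ K Q).comp ((rename ι).comp ψ) = Ideal.Quotient.mkₐ K Q := by
      apply MvPolynomial.algHom_ext
      rintro (v | v)
      · by_cases hv : v ∈ A
        · have := Ideal.Quotient.eq_zero_iff_mem.2 (hvar v hv).1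
          simp [hψl v hv, this]
        · simp [hψl' v hv, ι]
      · by_cases hv : v ∈ A
        · have := Ideal.Quotient.eq_zero_iff_mem.2 (hvar v hv).2
          simp [hψr v hv, this]
        · simp [hψr' v hv, ι]
    intro f hf
    have h1 := AlgHom.congr_fun hcomp f
    have h2 : ψ f = 0 := hf
    rw [AlgHom.comp_apply, AlgHom.comp_apply, h2, map_zero, map_zero] at h1
    exact Ideal.Quotient.eq_zero_iff_mem.1 h1.symm
  let m : Ideal (MvPolynomial (V ⊕ V) K) := RingHom.ker (aeval (fun _ => (0 : K)) :
    MvPolynomial (V ⊕ V) K →ₐ[K] K).toRingHom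
  have hmp : m.IsPrime := RingHom.ker_isPrime _
  have hspan : Ideal.span (Set.range (X : V ⊕ V → MvPolynomial (V ⊕ V) K)) ≤ m := by
    refine Ideal.span_le.2 ?_
    rintro _ ⟨i, rfl⟩
    change aeval (fun _ => (0 : K)) (X i : MvPolynomial (V ⊕ V) K) = 0
    simp
  have hPm : P ≤ m := by
    intro f hf
    have hc : (aeval (fun _ => (0 : K)) : MvPolynomial (B ⊕ B) K →ₐ[K] K).comp ψ =
        aeval (fun _ => (0 : K)) := by
      apply MvPolynomial.algHom_ext
      rintro (v | v)
      · by_cases hv : v ∈ A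
        · simp [hψl v hv]
        · simp [hψl' v hv]
      · by_cases hv : v ∈ A
        · simp [hψr v hv]
        · simp [hψr' v hv]
    change aeval (fun _ => (0 : K)) f = 0
    rw [← hc, AlgHom.comp_apply, (hmemP f).1 hf, map_zero]
  have hPass : P ∈ associatedPrimes (MvPolynomial (V ⊕ V) K)
      (MvPolynomial (V ⊕ V) K ⧸ binomialEdgeIdeal K G) := by
    apply Module.associatedPrimes.minimalPrimes_annihilator_subset_associatedPrimes
    rwa [Ideal.annihilator_quotient]
  have h1 := length_le_ringKrullDim m rs _ P hPass hPm (fun r hr => hspan (hrs r hr))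
    hreg.toIsWeaklyRegular
  have h2 : ringKrullDim (MvPolynomial (V ⊕ V) K ⧸ P) = ringKrullDim (MvPolynomial (B ⊕ B) K) :=
    ringKrullDim_eq_of_ringEquiv (RingHom.quotientKerEquivOfSurjective (f := ψ.toRingHom) hψs)
  rw [h2, MvPolynomial.ringKrullDim_of_isNoetherianRing, ringKrullDim_eq_zero_of_field,
    zero_add, Nat.card_sum] at h1
  have h3 : rs.length ≤ Nat.card B + Nat.card B := by exact_mod_cast h1
  change rs.length ≤ 2 * Nat.card B
  omega

end Helpers

lemma leviGraph_adj_lr {P ι : Type*} (C : ι → Set P) (S : Finset P) (p : {p // p ∈ S}) (i : ι) :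
    (leviGraph C S).Adj (Sum.inl p) (Sum.inr i) ↔ (p : P) ∈ C i := by
  simp [leviGraph]

lemma exists_two_of_ncard {α : Type*} {s : Set α} (h : 2 ≤ s.ncard) :
    ∃ a b, a ≠ b ∧ a ∈ s ∧ b ∈ s := by
  obtain ⟨a, b, ha, hb, hab⟩ := (Set.one_lt_ncard_iff (Set.finite_of_ncard_ne_zero (by omega))).1 h
  exact ⟨a, b, hab, ha, hb⟩


theorem leviGraph_conic_line_not_CM {P : Type*} {n k : ℕ}
    (hn : 1 ≤ n) (hk : 1 ≤ k) (L : Fin n → Set P) (Q : Fin k → Set P) (S : Finset P)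
    (hS : ∀ p : P, p ∈ S ↔ ∃ a b : Fin n ⊕ Fin k, a ≠ b ∧
        p ∈ Sum.elim L Q a ∧ p ∈ Sum.elim L Q b)
    (hLL : ∀ i j : Fin n, i ≠ j → (L i ∩ L j).ncard = 1)
    (hLQ : ∀ (i : Fin n) (j : Fin k), (L i ∩ Q j).ncard = 2)
    (hQQ : ∀ i j : Fin k, i ≠ j → (Q i ∩ Q j).ncard = 4)
    (K : Type*) [Field K] :
    (∀ v : {p // p ∈ S} ⊕ (Fin n ⊕ Fin k),
        2 ≤ ((leviGraph (Sum.elim L Q) S).neighborSet v).ncard) ∧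
    ¬ quotIsCM K (binomialEdgeIdeal K (leviGraph (Sum.elim L Q) S)) := by
  classical
  have hdeg : ∀ v : {p // p ∈ S} ⊕ (Fin n ⊕ Fin k),
      2 ≤ ((leviGraph (Sum.elim L Q) S).neighborSet v).ncard := by
    have two : ∀ (v : {p // p ∈ S} ⊕ (Fin n ⊕ Fin k)) a b, a ≠ b →
        (leviGraph (Sum.elim L Q) S).Adj v a → (leviGraph (Sum.elim L Q) S).Adj v b →
        2 ≤ ((leviGraph (Sum.elim L Q) S).neighborSet v).ncard := by
      intro v a b hab ha hb
      exact (Set.one_lt_ncard_iff (Set.toFinite _)).2 ⟨a, b, ha, hb, hab⟩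
    have curve : ∀ (i : Fin n) (j : Fin k), ∃ p q : {p // p ∈ S}, p ≠ q ∧
        ((p : P) ∈ L i ∧ (p : P) ∈ Q j) ∧ ((q : P) ∈ L i ∧ (q : P) ∈ Q j) := by
      intro i j
      obtain ⟨p, q, hpq, hp, hq⟩ := exists_two_of_ncard (hLQ i j).ge
      refine ⟨⟨p, (hS p).2 ⟨Sum.inl i, Sum.inr j, by simp, hp.1, hp.2⟩⟩,
        ⟨q, (hS q).2 ⟨Sum.inl i, Sum.inr j, by simp, hq.1, hq.2⟩⟩, ?_, hp, hq⟩
      simpa using hpq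
    rintro (p | i | j)
    · obtain ⟨a, b, hab, ha, hb⟩ := (hS p).1 p.2
      exact two _ (Sum.inr a) (Sum.inr b) (by simpa using hab)
        ((leviGraph_adj_lr _ _ _ _).2 ha) ((leviGraph_adj_lr _ _ _ _).2 hb)
    · obtain ⟨p, q, hpq, hp, hq⟩ := curve i ⟨0, hk⟩
      exact two _ (Sum.inl p) (Sum.inl q) (by simpa using hpq)
        ((leviGraph_adj_lr (Sum.elim L Q) S p (Sum.inl i)).2 hp.1).symm ((leviGraph_adj_lr (Sum.elim L Q) S q (Sum.inl i)).2 hq.1).symm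
    · obtain ⟨p, q, hpq, hp, hq⟩ := curve ⟨0, hn⟩ j
      exact two _ (Sum.inl p) (Sum.inl q) (by simpa using hpq)
        ((leviGraph_adj_lr (Sum.elim L Q) S p (Sum.inr j)).2 hp.2).symm ((leviGraph_adj_lr (Sum.elim L Q) S q (Sum.inr j)).2 hq.2).symm
  refine ⟨hdeg, fun hCM => ?_⟩
  have hbip : ∀ u v, (leviGraph (Sum.elim L Q) S).Adj u v → (u.isLeft ↔ v.isRight) := by
    rintro (u | u) (v | v) h <;> simp [leviGraph] at h ⊢
  have : Nonempty ({p // p ∈ S} ⊕ (Fin n ⊕ Fin k)) := ⟨Sum.inr (Sum.inl ⟨0, hn⟩)⟩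
  have hlow := card_succ_le_dim K (leviGraph (Sum.elim L Q) S)
  unfold quotIsCM at hCM
  rw [hCM] at hlow
  have hlow' : Nat.card ({p // p ∈ S} ⊕ (Fin n ⊕ Fin k)) + 1 ≤
      quotDepth K (binomialEdgeIdeal K (leviGraph (Sum.elim L Q) S)) := by
    have hlow2 : ((Nat.card ({p // p ∈ S} ⊕ (Fin n ⊕ Fin k)) + 1 : ℕ) : WithBot ℕ∞) ≤
        ((quotDepth K (binomialEdgeIdeal K (leviGraph (Sum.elim L Q) S)) : ℕ) : WithBot ℕ∞) := hlow
    exact_mod_cast hlow2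
  obtain ⟨rs, hlen, hrs, hreg⟩ : quotDepth K (binomialEdgeIdeal K (leviGraph (Sum.elim L Q) S)) ∈
      {d : ℕ | ∃ rs : List (MvPolynomial _ K), rs.length = d ∧
        (∀ r ∈ rs, r ∈ Ideal.span (Set.range X)) ∧ RingTheory.Sequence.IsRegular
          (MvPolynomial _ K ⧸ binomialEdgeIdeal K (leviGraph (Sum.elim L Q) S)) rs} := by
    unfold quotDepth at hlow' ⊢
    refine Nat.sSup_mem ?_ ?_
    · by_contra hne
      rw [Set.not_nonempty_iff_eq_empty] at hne
      rw [hne] at hlow'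
      simp at hlow'
    · by_contra hb
      rw [Nat.sSup_of_not_bddAbove hb] at hlow'
      omega
  have b1 := length_le_of_cover K _ {v | v.isLeft = true}
    (by
      intro u v h
      have := hbip u v h
      rcases u with u | u <;> rcases v with v | v <;> simp at this ⊢)
    (by
      intro v hv
      obtain ⟨a, b, hab, ha, hb⟩ := exists_two_of_ncard (hdeg v)
      refine ⟨a, b, hab, ?_, ?_, ha, hb⟩
      · have := (hbip v a ha).1 hv
        rcases a with a | a <;> simp at this ⊢
      · have := (hbip v b hb).1 hv
        rcases b with b | b <;> simp at this ⊢)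
    rs hrs hreg
  have b2 := length_le_of_cover K _ {v | v.isRight = true}
    (by
      intro u v h
      have := hbip u v h
      rcases u with u | u <;> rcases v with v | v <;> simp at this ⊢)
    (by
      intro v hv
      obtain ⟨a, b, hab, ha, hb⟩ := exists_two_of_ncard (hdeg v)
      refine ⟨a, b, hab, ?_, ?_, ha, hb⟩
      · have := (hbip a v ha.symm).2 hv
        rcases a with a | a <;> simp at this ⊢
      · have := (hbip b v hb.symm).2 hv
        rcases b with b | b <;> simp at this ⊢)
    rs hrs hreg
  have c1 : Nat.card {v : {p // p ∈ S} ⊕ (Fin n ⊕ Fin k) // v ∉ {v | v.isLeft = true}} =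
      Nat.card (Fin n ⊕ Fin k) := by
    refine (Nat.card_congr (Equiv.ofBijective
      (fun i => ⟨Sum.inr i, by simp⟩) ⟨?_, ?_⟩)).symm
    · intro i j h
      simpa using h
    · rintro ⟨v | v, hv⟩
      · simp at hv
      · exact ⟨v, rfl⟩
  have c2 : Nat.card {v : {p // p ∈ S} ⊕ (Fin n ⊕ Fin k) // v ∉ {v | v.isRight = true}} =
      Nat.card {p // p ∈ S} := by
    refine (Nat.card_congr (Equiv.ofBijective
      (fun i => ⟨Sum.inl i, by simp⟩) ⟨?_, ?_⟩)).symm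
    · intro i j h
      simpa using h
    · rintro ⟨v | v, hv⟩
      · exact ⟨v, rfl⟩
      · simp at hv
  rw [c1] at b1
  rw [c2] at b2
  rw [Nat.card_sum] at hlow'
  omega
end
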